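/- Let n ≥ 2, let T = ℝ^n/ℤ^n, and let s : S^{n−1} → T be a continuous injective map such that every loop contained in s(S^{n−1}) is null-homotopic in T (equivalently, s lifts through the covering map p : ℝ^n → T). Then T \ s(S^{n−1}) has exactly two connected components, and s(S^{n−1}) is the topological boundary of each of them. -/

import Mathlib

open Pointwise

section JordanBrouwerTorus

open MeasureTheory Set Filter Topology
open scoped ContDiff

section Jacobian

variable {ι : Type*} [Fintype ι] [DecidableEq ι]

/-- The determinant as a continuous multilinear map of the rows. -/
noncomputable def detRow : ContinuousMultilinearMap ℝ (fun _ : ι => ι → ℝ) ℝ where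
  toMultilinearMap := (Matrix.detRowAlternating (R := ℝ) (n := ι)).toMultilinearMap
  cont := (continuous_id (X := Matrix ι ι ℝ)).matrix_det

lemma detRow_apply (a : ι → ι → ℝ) : detRow a = Matrix.det (Matrix.of a) := rfl

lemma detRow_update_swap (a : ι → ι → ℝ) (w v : ι → ℝ) {i j : ι} (hij : i ≠ j) :
    detRow (Function.update (Function.update a i w) j v) =
      - detRow (Function.update (Function.update a j w) i v) := by
  have h := (Matrix.detRowAlternating (R := ℝ) (n := ι)).map_swap
    (Function.update (Function.update a j w) i v) hij
  have h2 : (Function.update (Function.update a j w) i v) ∘ Equiv.swap i j =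
      Function.update (Function.update a i w) j v := by
    funext k
    by_cases hi : k = i
    · subst hi
      simp [Function.update_of_ne hij, Function.update_of_ne hij.symm]
    · by_cases hj : k = j
      · subst hj
        simp
      · simp [Equiv.swap_apply_of_ne_of_ne hi hj, Function.update_of_ne hi,
          Function.update_of_ne hj]
  rw [h2] at h
  exact h

lemma sum_detRow_update_update (a b : ι → ι → ℝ) (w : ι → ℝ) (S : ι → ι → ι → ℝ)
    (hS : ∀ i j, S i j = S j i) :
    ∑ i, ∑ j, detRow (Function.update (Function.update a i w) j
      (Function.update (S i) i (b i) j)) = ∑ i, detRow (Function.update a i (b i)) := by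
  set T : ι → ι → ℝ := fun i j => if i = j then 0 else
    detRow (Function.update (Function.update a i w) j (S i j)) with hT
  have hTa : ∀ i j, T i j = - T j i := by
    intro i j
    by_cases h : i = j
    · simp [hT, h]
    · simp only [hT, h, Ne.symm h, if_false]
      rw [hS j i]
      exact detRow_update_swap a w _ h
  have hT0 : ∑ i, ∑ j, T i j = 0 := by
    have h1 : ∑ i, ∑ j, T i j = - ∑ i, ∑ j, T i j := by
      conv_lhs => rw [Finset.sum_comm]
      rw [← Finset.sum_neg_distrib]
      refine Finset.sum_congr rfl fun i _ => ?_
      rw [← Finset.sum_neg_distrib]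
      exact Finset.sum_congr rfl fun j _ => hTa j i
    linarith
  have key : ∀ i, ∑ j, detRow (Function.update (Function.update a i w) j
      (Function.update (S i) i (b i) j)) =
      ∑ j, T i j + detRow (Function.update a i (b i)) := by
    intro i
    rw [← Finset.add_sum_erase _ _ (Finset.mem_univ i),
      ← Finset.add_sum_erase _ (fun j => T i j) (Finset.mem_univ i)]
    have : ∑ j ∈ Finset.univ.erase i, detRow (Function.update (Function.update a i w) j
      (Function.update (S i) i (b i) j)) = ∑ j ∈ Finset.univ.erase i, T i j := by
      refine Finset.sum_congr rfl fun j hj => ?_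
      have hj : j ≠ i := Finset.ne_of_mem_erase hj
      simp [hT, hj.symm, Function.update_of_ne hj]
    rw [this]
    simp [hT]
    ring
  simp_rw [key]
  rw [Finset.sum_add_distrib, hT0, zero_add]

lemma sum_apply_mul_detRow_update (a : ι → ι → ℝ) (w : ι → ℝ) (l : (ι → ℝ) →L[ℝ] ℝ) :
    ∑ i, l (a i) * detRow (Function.update a i w) = l w * detRow a := by
  have h := Matrix.mulVec_cramer (Matrix.of a).transpose w
  have h2 : ∑ i, detRow (Function.update a i w) • a i = detRow a • w := by
    rw [Matrix.det_transpose] at h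
    change _ = (Matrix.of a).det • w
    rw [← h]
    funext k
    simp only [Matrix.mulVec, dotProduct, Finset.sum_apply, Pi.smul_apply, smul_eq_mul,
      Matrix.cramer_transpose_apply, Matrix.transpose_apply, Matrix.of_apply]
    refine Finset.sum_congr rfl fun i _ => ?_
    rw [mul_comm]
    rfl
  have h3 := congrArg l h2
  simp only [map_sum, map_smul, smul_eq_mul] at h3
  rw [mul_comm (l w), ← h3]
  exact Finset.sum_congr rfl fun i _ => mul_comm _ _

/-- The tuple of partial derivatives of a map. -/
noncomputable def partials (g : (ι → ℝ) → (ι → ℝ)) (x : ι → ℝ) (i : ι) : ι → ℝ :=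
  fderiv ℝ g x (Pi.single i 1)

/-- The Jacobian determinant. -/
noncomputable def jacobian (g : (ι → ℝ) → (ι → ℝ)) (x : ι → ℝ) : ℝ := detRow (partials g x)

lemma jacobian_eq_det (g : (ι → ℝ) → (ι → ℝ)) (x : ι → ℝ) :
    jacobian g x = LinearMap.det (fderiv ℝ g x : (ι → ℝ) →ₗ[ℝ] (ι → ℝ)) := by
  rw [← LinearMap.det_toMatrix', ← Matrix.det_transpose, jacobian, detRow_apply]
  congr 1

lemma jacobian_comp {g f : (ι → ℝ) → (ι → ℝ)} (hg : Differentiable ℝ g)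
    (hf : Differentiable ℝ f) (x : ι → ℝ) :
    jacobian (g ∘ f) x = jacobian g (f x) * jacobian f x := by
  simp only [jacobian_eq_det]
  rw [fderiv_comp x (hg _) (hf _)]
  exact LinearMap.det_comp _ _

lemma contDiff_partials {g : (ι → ℝ) → (ι → ℝ)} (hg : ContDiff ℝ ∞ g) :
    ContDiff ℝ ∞ (partials g) := by
  refine contDiff_pi.2 fun i => ?_
  exact (hg.fderiv_right (m := ∞) (by simp)).clm_apply contDiff_const

lemma contDiff_jacobian {g : (ι → ℝ) → (ι → ℝ)} (hg : ContDiff ℝ ∞ g) :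
    ContDiff ℝ ∞ (jacobian g) :=
  (detRow (ι := ι)).contDiff.comp (contDiff_partials hg)

lemma partials_add_smul {f u : (ι → ℝ) → (ι → ℝ)} (hf : Differentiable ℝ f)
    (hu : Differentiable ℝ u) (t : ℝ) (x : ι → ℝ) :
    partials (fun x => f x + t • u x) x = partials f x + t • partials u x := by
  funext i
  simp only [partials, Pi.add_apply, Pi.smul_apply]
  rw [fderiv_fun_add (hf x) ((hu x).fun_const_smul t), fderiv_fun_const_smul (hu x)]
  rfl

/-- The partial derivative in direction `i` of `ρ (g) · det (∂₁g, …, w, …, ∂ₙg)`, with `w` in the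
`i`-th place. -/
noncomputable def fluxDeriv (ρ : (ι → ℝ) → ℝ) (g w : (ι → ℝ) → (ι → ℝ)) (i : ι) (x : ι → ℝ) : ℝ :=
  fderiv ℝ (fun x => ρ (g x) * detRow (Function.update (partials g x) i (w x))) x (Pi.single i 1)

lemma contDiff_flux {ρ : (ι → ℝ) → ℝ} {g w : (ι → ℝ) → (ι → ℝ)} (hρ : ContDiff ℝ ∞ ρ)
    (hg : ContDiff ℝ ∞ g) (hw : ContDiff ℝ ∞ w) (i : ι) :
    ContDiff ℝ ∞ (fun x => ρ (g x) * detRow (Function.update (partials g x) i (w x))) := by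
  refine (hρ.comp hg).mul ((detRow (ι := ι)).contDiff.comp
    (?_ : ContDiff ℝ ∞ fun x => Function.update (partials g x) i (w x)))
  refine contDiff_pi.2 fun j => ?_
  by_cases h : j = i
  · subst h; simpa using hw
  · simpa [Function.update_of_ne h] using contDiff_pi.1 (contDiff_partials hg) j

lemma fluxDeriv_eq {ρ : (ι → ℝ) → ℝ} {g w : (ι → ℝ) → (ι → ℝ)} (hρ : ContDiff ℝ ∞ ρ)
    (hg : ContDiff ℝ ∞ g) (hw : ContDiff ℝ ∞ w) (i : ι) (x : ι → ℝ) :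
    fluxDeriv ρ g w i x =
      ρ (g x) * ∑ j, detRow (Function.update (Function.update (partials g x) i (w x)) j
        (Function.update (fun j => fderiv ℝ (fderiv ℝ g) x (Pi.single i 1) (Pi.single j 1)) i
          (partials w x i) j)) +
      fderiv ℝ ρ (g x) (partials g x i) * detRow (Function.update (partials g x) i (w x)) := by
  have hg1 : HasFDerivAt g (fderiv ℝ g x) x := (hg.differentiable (by simp) x).hasFDerivAt
  have hw1 : HasFDerivAt w (fderiv ℝ w x) x := (hw.differentiable (by simp) x).hasFDerivAt
  have hg2 : HasFDerivAt (fderiv ℝ g) (fderiv ℝ (fderiv ℝ g) x) x :=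
    ((hg.fderiv_right (m := ∞) (by simp)).differentiable (by simp) x).hasFDerivAt
  have hρ1 : HasFDerivAt ρ (fderiv ℝ ρ (g x)) (g x) :=
    (hρ.differentiable (by simp) _).hasFDerivAt
  let φ' : ι → (ι → ℝ) →L[ℝ] (ι → ℝ) := fun j => if j = i then fderiv ℝ w x else
    (fderiv ℝ (fderiv ℝ g) x).flip (Pi.single j 1)
  have hφ : HasFDerivAt (fun x => Function.update (partials g x) i (w x))
      (ContinuousLinearMap.pi φ') x := by
    refine hasFDerivAt_pi.2 fun j => ?_
    by_cases h : j = i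
    · subst h; simpa [φ'] using hw1
    · simp only [Function.update_of_ne h, φ', if_neg h, partials]
      exact (hg2.clm_apply (hasFDerivAt_const (Pi.single j 1) x)).congr_fderiv (by ext; simp)
  have hd := (detRow.hasFDerivAt (Function.update (partials g x) i (w x))).comp x hφ
  have hm := (hρ1.comp x hg1).mul hd
  rw [fluxDeriv]
  have := hm.fderiv
  simp only [Function.comp_def] at this
  erw [this]
  simp only [_root_.add_apply, _root_.smul_apply, ContinuousLinearMap.comp_apply, smul_eq_mul]
  rw [ContinuousMultilinearMap.linearDeriv_apply, mul_comm (detRow _)]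
  congr 2
  refine Finset.sum_congr rfl fun j _ => ?_
  congr 2
  by_cases h : j = i
  · subst h; simp [φ', partials]
  · simp [φ', h]

lemma hasDerivAt_homotopy {ρ : (ι → ℝ) → ℝ} {f u : (ι → ℝ) → (ι → ℝ)} (hρ : ContDiff ℝ ∞ ρ)
    (hf : ContDiff ℝ ∞ f) (hu : ContDiff ℝ ∞ u) (t : ℝ) (x : ι → ℝ) :
    HasDerivAt (fun t : ℝ => ρ (f x + t • u x) * jacobian (fun x => f x + t • u x) x)
      (∑ i, fluxDeriv ρ (fun x => f x + t • u x) u i x) t := by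
  have hfu : ContDiff ℝ ∞ (fun x => f x + t • u x) :=
    hf.add (contDiff_const (c := t) |>.fun_smul hu)
  have hsymm := hfu.contDiffAt (x := x) |>.isSymmSndFDerivAt
    (by simpa using WithTop.coe_le_coe.2 (le_top : (2 : ℕ∞) ≤ ⊤))
  simp_rw [fluxDeriv_eq hρ hfu hu, Finset.sum_add_distrib]
  rw [sum_apply_mul_detRow_update, ← Finset.mul_sum, sum_detRow_update_update _ _ _
    (fun i j => fderiv ℝ (fderiv ℝ (fun x => f x + t • u x)) x (Pi.single i 1) (Pi.single j 1))
    (fun i j => hsymm _ _)]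
  have hp : ∀ t : ℝ, jacobian (fun x => f x + t • u x) x =
      detRow (partials f x + t • partials u x) := fun t => by
    rw [jacobian, partials_add_smul (hf.differentiable (by simp)) (hu.differentiable (by simp))]
  simp_rw [hp]
  rw [partials_add_smul (hf.differentiable (by simp)) (hu.differentiable (by simp))]
  have h1 : HasDerivAt (fun t : ℝ => f x + t • u x) (u x) t := by
    simpa using ((hasDerivAt_id t).smul_const (u x)).const_add (f x)
  have h2 : HasDerivAt (fun t : ℝ => partials f x + t • partials u x) (partials u x) t := by
    simpa using ((hasDerivAt_id t).smul_const (partials u x)).const_add (partials f x)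
  have h3 := ((hρ.differentiable (by simp) (f x + t • u x)).hasFDerivAt.comp_hasDerivAt t h1).mul
    ((detRow.hasFDerivAt _).comp_hasDerivAt t h2)
  refine h3.congr_deriv ?_
  simp only [Function.comp_apply]
  rw [ContinuousMultilinearMap.linearDeriv_apply, add_comm]
end Jacobian

section Homotopy

variable {ι : Type*} [Fintype ι] [DecidableEq ι]

lemma integral_mul_fluxDeriv_eq_zero {χ ρ : (ι → ℝ) → ℝ} {g w : (ι → ℝ) → (ι → ℝ)}
    (hχ : ContDiff ℝ ∞ χ) (hχc : HasCompactSupport χ) (hρ : ContDiff ℝ ∞ ρ)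
    (hg : ContDiff ℝ ∞ g) (hw : ContDiff ℝ ∞ w)
    (h0 : ∀ x, fderiv ℝ χ x ≠ 0 → ρ (g x) = 0) :
    ∫ x, χ x * ∑ i, fluxDeriv ρ g w i x = 0 := by
  have hχ' : Continuous (fderiv ℝ χ) := hχ.continuous_fderiv (by simp)
  have hV := fun i => contDiff_flux hρ hg hw i
  have hV' : ∀ i, Continuous (fluxDeriv ρ g w i) := fun i =>
    ((hV i).continuous_fderiv (by simp)).clm_apply continuous_const
  have hi : ∀ i, Integrable (fun x => χ x * fluxDeriv ρ g w i x) := fun i =>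
    (hχ.continuous.mul (hV' i)).integrable_of_hasCompactSupport hχc.mul_right
  simp_rw [Finset.mul_sum]
  rw [integral_finsetSum _ fun i _ => hi i]
  refine Finset.sum_eq_zero fun i _ => ?_
  have hd : Continuous fun x => fderiv ℝ χ x (Pi.single i 1) := hχ'.clm_apply continuous_const
  have hdc : HasCompactSupport fun x => fderiv ℝ χ x (Pi.single i 1) :=
    (hχc.fderiv_apply (𝕜 := ℝ) _)
  have h := integral_mul_fderiv_eq_neg_fderiv_mul_of_integrable (μ := volume) (f := χ)
    (g := fun x => ρ (g x) * detRow (Function.update (partials g x) i (w x)))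
    (v := Pi.single i 1)
    ((hd.mul (hV i).continuous).integrable_of_hasCompactSupport hdc.mul_right) (hi i)
    ((hχ.continuous.mul (hV i).continuous).integrable_of_hasCompactSupport hχc.mul_right)
    (fun x _ => hχ.differentiable (by simp) x) (fun x _ => (hV i).differentiable (by simp) x)
  refine h.trans ?_
  rw [neg_eq_zero]
  refine integral_eq_zero_of_ae (Eventually.of_forall fun x => ?_)
  by_cases hx : fderiv ℝ χ x = 0
  · simp [hx]
  · simp [h0 x hx]

lemma integral_homotopy {χ ρ : (ι → ℝ) → ℝ} {f u : (ι → ℝ) → (ι → ℝ)}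
    (hχ : ContDiff ℝ ∞ χ) (hχc : HasCompactSupport χ) (hρ : ContDiff ℝ ∞ ρ)
    (hf : ContDiff ℝ ∞ f) (hu : ContDiff ℝ ∞ u)
    (h0 : ∀ t ∈ Icc (0 : ℝ) 1, ∀ x, fderiv ℝ χ x ≠ 0 → ρ (f x + t • u x) = 0) :
    ∫ x, χ x * (ρ (f x) * jacobian f x) =
      ∫ x, χ x * (ρ (f x + u x) * jacobian (fun x => f x + u x) x) := by
  set G : ℝ × (ι → ℝ) → ℝ := fun p => ρ (f p.2 + p.1 • u p.2) *
    detRow (partials f p.2 + p.1 • partials u p.2) with hG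
  have hfd := hf.differentiable (by simp)
  have hud := hu.differentiable (by simp)
  have hGj : ∀ t x, G (t, x) = ρ (f x + t • u x) * jacobian (fun x => f x + t • u x) x := by
    intro t x
    simp only [hG, jacobian, partials_add_smul hfd hud]
  have hGs : ContDiff ℝ ∞ G := by
    have h1 : ContDiff ℝ ∞ fun p : ℝ × (ι → ℝ) => f p.2 + p.1 • u p.2 :=
      (hf.comp contDiff_snd).add (contDiff_fst.smul (hu.comp contDiff_snd))
    have h2 : ContDiff ℝ ∞ fun p : ℝ × (ι → ℝ) => partials f p.2 + p.1 • partials u p.2 :=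
      ((contDiff_partials hf).comp contDiff_snd).add
        (contDiff_fst.smul ((contDiff_partials hu).comp contDiff_snd))
    exact (hρ.comp h1).mul ((detRow (ι := ι)).contDiff.comp h2)
  set H : ℝ → (ι → ℝ) → ℝ := fun t x => χ x * fderiv ℝ G (t, x) (1, 0) with hH
  have hHc : Continuous fun p : ℝ × (ι → ℝ) => H p.1 p.2 :=
    (hχ.continuous.comp continuous_snd).mul
      ((hGs.continuous_fderiv (by simp)).clm_apply continuous_const)
  have hGt : ∀ t x, HasDerivAt (fun t => G (t, x)) (fderiv ℝ G (t, x) (1, 0)) t := by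
    intro t x
    have h1 : HasDerivAt (fun t : ℝ => (t, x)) ((1 : ℝ), (0 : ι → ℝ)) t :=
      (hasDerivAt_id t).prodMk (hasDerivAt_const t x)
    exact (hGs.differentiable (by simp) (t, x)).hasFDerivAt.comp_hasDerivAt t h1
  have hflux : ∀ t x, fderiv ℝ G (t, x) (1, 0) =
      ∑ i, fluxDeriv ρ (fun x => f x + t • u x) u i x := by
    intro t x
    refine (hGt t x).unique ?_
    simp_rw [hGj]
    exact hasDerivAt_homotopy hρ hf hu t x
  have hGx : ∀ t, Continuous fun x => χ x * G (t, x) := fun t =>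
    hχ.continuous.mul (hGs.continuous.comp (by fun_prop))
  have hderiv : ∀ t, HasDerivAt (fun t => ∫ x, χ x * G (t, x)) (∫ x, H t x) t := by
    intro t
    obtain ⟨C, hC⟩ :=
      ((isCompact_Icc (a := t - 1) (b := t + 1)).prod hχc.isCompact).exists_bound_of_continuousOn
      hHc.continuousOn
    refine (hasDerivAt_integral_of_dominated_loc_of_deriv_le (μ := volume)
      (F := fun t x => χ x * G (t, x)) (F' := H)
      (bound := (tsupport χ).indicator fun _ => C)
      (Icc_mem_nhds (by linarith : t - 1 < t) (by linarith : t < t + 1))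
      (Eventually.of_forall fun t => (hGx t).aestronglyMeasurable)
      ((hGx t).integrable_of_hasCompactSupport hχc.mul_right)
      (hHc.comp (by fun_prop : Continuous fun x => (t, x))).aestronglyMeasurable
      (Eventually.of_forall fun x s hs => ?_) ?_
      (Eventually.of_forall fun x s hs => (hGt s x).const_mul _)).2
    · by_cases hx : x ∈ tsupport χ
      · simpa [hx] using hC (s, x) ⟨hs, hx⟩
      · simp [hx, hH, image_eq_zero_of_notMem_tsupport hx]
    · exact (integrable_indicator_iff (isClosed_tsupport χ).measurableSet).2
        (integrableOn_const hχc.isCompact.measure_lt_top.ne)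
  have hzero : ∀ t ∈ Icc (0 : ℝ) 1, ∫ x, H t x = 0 := by
    intro t ht
    simp_rw [hH, hflux]
    exact integral_mul_fluxDeriv_eq_zero hχ hχc hρ
      (hf.add (contDiff_const (c := t) |>.fun_smul hu)) hu (h0 t ht)
  have hconst := constant_of_has_deriv_right_zero (f := fun t => ∫ x, χ x * G (t, x))
    (a := 0) (b := 1) (fun t _ => (hderiv t).continuousAt.continuousWithinAt)
    (fun t ht => by
      have := (hderiv t).hasDerivWithinAt (s := Ici t)
      rwa [hzero t (Ico_subset_Icc_self ht)] at this) 1 (by simp)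
  simp only [hGj, zero_smul, add_zero, one_smul] at hconst
  exact hconst.symm

end Homotopy

section Degree

variable {ι : Type*} [Fintype ι]

/-- `c` vanishes on `K`, is locally constant off `K`, and has bounded support. -/
structure IsLocConstOff (K : Set (ι → ℝ)) (c : (ι → ℝ) → ℝ) : Prop where
  zero_on : ∀ x ∈ K, c x = 0
  eventually_eq : ∀ x ∉ K, ∀ᶠ y in 𝓝 x, c y = c x
  bounded_support : ∃ R, ∀ x, R < ‖x‖ → c x = 0

lemma IsLocConstOff.exists_cutoff {K U : Set (ι → ℝ)} {c : (ι → ℝ) → ℝ} (hc : IsLocConstOff K c)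
    (hK : IsClosed K) (hU : IsOpen U) (hKU : K ⊆ U) :
    ∃ χ : (ι → ℝ) → ℝ, ContDiff ℝ ∞ χ ∧ HasCompactSupport χ ∧
      ∀ x ∉ U, χ x = c x ∧ fderiv ℝ χ x = 0 := by
  obtain ⟨w, hw0, hw1, -⟩ := exists_contMDiffMap_zero_one_nhds_of_isClosed
    (modelWithCornersSelf ℝ (ι → ℝ)) (n := ⊤) hK hU.isClosed_compl
    (disjoint_compl_right_iff_subset.2 hKU)
  have hws : ContDiff ℝ ∞ w := w.contMDiff.contDiff
  refine ⟨fun x => c x * w x, ?_, ?_, ?_⟩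
  · rw [contDiff_iff_contDiffAt]
    intro x
    by_cases hx : x ∈ K
    · have : (fun x => c x * w x) =ᶠ[𝓝 x] fun _ => 0 := by
        filter_upwards [eventually_nhdsSet_iff_forall.1 hw0 x hx] with y hy
        simp [hy]
      exact contDiffAt_const.congr_of_eventuallyEq this
    · have : (fun x => c x * w x) =ᶠ[𝓝 x] fun y => c x * w y := by
        filter_upwards [hc.eventually_eq x hx] with y hy
        simp [hy]
      exact (contDiffAt_const.mul hws.contDiffAt).congr_of_eventuallyEq this
  · obtain ⟨R, hR⟩ := hc.bounded_support
    refine HasCompactSupport.intro (isCompact_closedBall 0 R) fun x hx => ?_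
    simp [hR x (by simpa using hx)]
  · intro x hx
    have hxK : x ∉ K := fun h => hx (hKU h)
    have h1 := eventually_nhdsSet_iff_forall.1 hw1 x hx
    have : (fun x => c x * w x) =ᶠ[𝓝 x] fun _ => c x := by
      filter_upwards [hc.eventually_eq x hxK, h1] with y hy hy'
      simp [hy, hy']
    refine ⟨this.eq_of_nhds, ?_⟩
    rw [this.fderiv_eq]
    simp

variable (ι) in
/-- A smooth probability density supported in the ball of radius `1 / 2`. -/
noncomputable def kern : (ι → ℝ) → ℝ :=
  (⟨1 / 4, 1 / 2, by norm_num, by norm_num⟩ : ContDiffBump (0 : ι → ℝ)).normed volume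

lemma contDiff_kern : ContDiff ℝ ∞ (kern ι) := ContDiffBump.contDiff_normed _

lemma integral_kern : ∫ x, kern ι x = 1 := ContDiffBump.integral_normed _

lemma kern_eq_zero {x : ι → ℝ} (hx : 1 / 2 ≤ ‖x‖) : kern ι x = 0 := by
  by_contra h
  have : x ∈ Function.support (kern ι) := h
  rw [kern, ContDiffBump.support_normed_eq] at this
  simp only [Metric.mem_ball, dist_zero_right] at this
  linarith

lemma exists_smooth_close {f : (ι → ℝ) → (ι → ℝ)} (hf : Continuous f) {ε : ℝ} (hε : 0 < ε) :
    ∃ g, ContDiff ℝ ∞ g ∧ ∀ x, ‖g x - f x‖ < ε := by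
  obtain ⟨g, hg, h, -⟩ := hf.exists_contDiff_approx (n := ⊤) (continuous_const (y := ε)) fun _ => hε
  exact ⟨g, hg, fun x => by simpa [dist_eq_norm] using h x⟩

/-- `g` is smooth and close to a positive multiple of `f - y` on `K`. -/
structure IsApprox (K : Set (ι → ℝ)) (f : (ι → ℝ) → (ι → ℝ)) (y : ι → ℝ) (l : ℝ)
    (g : (ι → ℝ) → (ι → ℝ)) : Prop where
  smooth : ContDiff ℝ ∞ g
  pos : 0 < l
  close : ∀ x ∈ K, ‖g x - l • (f x - y)‖ + 1 ≤ l * ‖f x - y‖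

lemma exists_isApprox {K : Set (ι → ℝ)} (hK : IsCompact K) {f : (ι → ℝ) → (ι → ℝ)}
    (hf : Continuous f) {y : ι → ℝ} (hy : y ∉ f '' K) :
    ∃ l g, IsApprox K f y l g ∧ ∀ x ∈ K, ‖g x - l • (f x - y)‖ + 2 ≤ l * ‖f x - y‖ := by
  obtain ⟨δ, hδ, hδK⟩ : ∃ δ > 0, ∀ x ∈ K, δ ≤ ‖f x - y‖ := by
    rcases K.eq_empty_or_nonempty with rfl | hne
    · exact ⟨1, one_pos, by simp⟩
    · obtain ⟨x, hx, hmin⟩ := hK.exists_isMinOn hne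
        (f := fun x => ‖f x - y‖) (by fun_prop)
      refine ⟨‖f x - y‖, norm_pos_iff.2 (sub_ne_zero.2 fun h => hy ⟨x, hx, h⟩), fun z hz => hmin hz⟩
  obtain ⟨F, hF, hFf⟩ := exists_smooth_close hf (ε := δ / 3) (by positivity)
  have key : ∀ x ∈ K, ‖(3 / δ) • (F x - y) - (3 / δ) • (f x - y)‖ + 2 ≤ 3 / δ * ‖f x - y‖ := by
    intro x hx
    rw [show (3 / δ) • (F x - y) - (3 / δ) • (f x - y) = (3 / δ) • (F x - f x) by module, norm_smul,
      Real.norm_of_nonneg (by positivity)]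
    have h1 : 3 / δ * ‖F x - f x‖ ≤ 3 / δ * (δ / 3) := by gcongr; exact (hFf x).le
    have h2 : 3 / δ * δ ≤ 3 / δ * ‖f x - y‖ := by gcongr; exact hδK x hx
    have h3 : 3 / δ * (δ / 3) = 1 := by field_simp
    have h4 : 3 / δ * δ = 3 := by field_simp
    linarith
  exact ⟨3 / δ, fun x => (3 / δ) • (F x - y),
    ⟨(contDiff_const (c := 3 / δ)).fun_smul (hF.sub contDiff_const), by positivity,
      fun x hx => by linarith [key x hx]⟩, key⟩

variable [DecidableEq ι]

/-- The number of zeros of `g`, counted with sign and with the weight `c`. -/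
noncomputable def zeroCount (c : (ι → ℝ) → ℝ) (g : (ι → ℝ) → (ι → ℝ)) : ℝ :=
  ∫ x, c x * (kern ι (g x) * jacobian g x)

lemma zeroCount_smul (a : ℝ) (c : (ι → ℝ) → ℝ) (g : (ι → ℝ) → (ι → ℝ)) :
    zeroCount (fun x => a * c x) g = a * zeroCount c g := by
  simp [zeroCount, mul_assoc, integral_const_mul]

lemma zeroCount_homotopy {K : Set (ι → ℝ)} {c : (ι → ℝ) → ℝ} (hK : IsCompact K)
    (hc : IsLocConstOff K c) {f₀ f₁ : (ι → ℝ) → (ι → ℝ)} (h₀ : ContDiff ℝ ∞ f₀)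
    (h₁ : ContDiff ℝ ∞ f₁)
    (h : ∀ t ∈ Icc (0 : ℝ) 1, ∀ x ∈ K, 1 / 2 < ‖f₀ x + t • (f₁ x - f₀ x)‖) :
    zeroCount c f₀ = zeroCount c f₁ := by
  obtain ⟨V, U, -, hU, hV, hKU, hsub⟩ := generalized_tube_lemma
    (isCompact_Icc (a := (0 : ℝ)) (b := 1)) hK
    (n := {p : ℝ × (ι → ℝ) | 1 / 2 < ‖f₀ p.2 + p.1 • (f₁ p.2 - f₀ p.2)‖})
    (isOpen_lt continuous_const (by
      have := h₀.continuous
      have := h₁.continuous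
      fun_prop)) (fun p hp => h p.1 hp.1 p.2 hp.2)
  obtain ⟨χ, hχ, hχc, hχU⟩ := hc.exists_cutoff hK.isClosed hU hKU
  have hz : ∀ t ∈ Icc (0 : ℝ) 1, ∀ x ∈ U, kern ι (f₀ x + t • (f₁ x - f₀ x)) = 0 :=
    fun t ht x hx => kern_eq_zero (le_of_lt (hsub (show (t, x) ∈ V ×ˢ U from ⟨hV ht, hx⟩)))
  have key := integral_homotopy hχ hχc (contDiff_kern (ι := ι)) h₀ (h₁.sub h₀)
    (fun t ht x hx => hz t ht x (by
      by_contra hxU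
      exact hx (hχU x hxU).2))
  simp only [add_sub_cancel] at key
  have e2 : ∀ g : (ι → ℝ) → (ι → ℝ), (∀ x ∈ U, kern ι (g x) = 0) →
      zeroCount c g = ∫ x, χ x * (kern ι (g x) * jacobian g x) := by
    intro g hg
    refine integral_congr_ae (Eventually.of_forall fun x => ?_)
    by_cases hx : x ∈ U
    · simp [hg x hx]
    · simp [(hχU x hx).1]
  rw [e2 f₀ fun x hx => by simpa using hz 0 (by simp) x hx,
    e2 f₁ fun x hx => by simpa using hz 1 (by simp) x hx, key]

lemma zeroCount_eq_of_close {K : Set (ι → ℝ)} {c : (ι → ℝ) → ℝ} (hK : IsCompact K)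
    (hc : IsLocConstOff K c) {f₀ f₁ h : (ι → ℝ) → (ι → ℝ)} (h₀ : ContDiff ℝ ∞ f₀)
    (h₁ : ContDiff ℝ ∞ f₁) (hf₀ : ∀ x ∈ K, ‖f₀ x - h x‖ + 3 / 4 ≤ ‖h x‖)
    (hf₁ : ∀ x ∈ K, ‖f₁ x - h x‖ + 3 / 4 ≤ ‖h x‖) :
    zeroCount c f₀ = zeroCount c f₁ := by
  refine zeroCount_homotopy hK hc h₀ h₁ fun t ht x hx => ?_
  have e : h x = (f₀ x + t • (f₁ x - f₀ x)) -
      ((1 - t) • (f₀ x - h x) + t • (f₁ x - h x)) := by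
    module
  have h1 : ‖h x‖ ≤ ‖f₀ x + t • (f₁ x - f₀ x)‖ +
      ((1 - t) * ‖f₀ x - h x‖ + t * ‖f₁ x - h x‖) := by
    conv_lhs => rw [e]
    refine (norm_sub_le _ _).trans ?_
    gcongr
    refine (norm_add_le _ _).trans ?_
    rw [norm_smul, norm_smul, Real.norm_of_nonneg ht.1, Real.norm_of_nonneg (by linarith [ht.2])]
  have h2 := hf₀ x hx
  have h3 := hf₁ x hx
  nlinarith [ht.1, ht.2]

lemma zeroCount_eq_of_isApprox {K : Set (ι → ℝ)} {c : (ι → ℝ) → ℝ} (hK : IsCompact K)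
    (hc : IsLocConstOff K c) {f g g' : (ι → ℝ) → (ι → ℝ)} (hf : Continuous f) {y : ι → ℝ}
    {l l' : ℝ} (h : IsApprox K f y l g) (h' : IsApprox K f y l' g') :
    zeroCount c g = zeroCount c g' := by
  obtain ⟨F, hF, hFf⟩ := exists_smooth_close hf (ε := 1 / (4 * (l + l')))
    (by have := h.pos; have := h'.pos; positivity)
  have hclose : ∀ m : ℝ, 0 < m → m ≤ l + l' → ∀ x, m * ‖F x - f x‖ ≤ 1 / 4 := by
    intro m hm hml x
    have h1 := (hFf x).le
    rw [le_div_iff₀ (by linarith)] at h1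
    nlinarith [norm_nonneg (F x - f x)]
  have hs : ∀ m : ℝ, ContDiff ℝ ∞ fun x => m • (F x - y) := fun m =>
    (contDiff_const (c := m)).fun_smul (hF.sub contDiff_const)
  have h1 : ∀ {m : ℝ} {k : (ι → ℝ) → (ι → ℝ)}, IsApprox K f y m k → m ≤ l + l' →
      zeroCount c k = zeroCount c fun x => m • (F x - y) := by
    intro m k hk hm
    refine zeroCount_eq_of_close hK hc (h := fun x => m • (f x - y)) hk.smooth (hs m)
      (fun x hx => ?_) fun x hx => ?_
    · have := hk.close x hx
      rw [norm_smul, Real.norm_of_nonneg hk.pos.le]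
      linarith
    · have := hk.close x hx
      have h2 := hclose m hk.pos hm x
      rw [norm_smul, Real.norm_of_nonneg hk.pos.le,
        show m • (F x - y) - m • (f x - y) = m • (F x - f x) by module, norm_smul,
        Real.norm_of_nonneg hk.pos.le]
      linarith [norm_nonneg (k x - m • (f x - y))]
  rw [h1 h (by linarith [h'.pos]), h1 h' (by linarith [h.pos])]
  refine zeroCount_homotopy hK hc (hs _) (hs _) fun t ht x hx => ?_
  have hl := h.pos
  have hl' := h'.pos
  set m := (1 - t) * l + t * l' with hm
  have hmpos : 0 < m := by
    rcases ht.1.eq_or_lt with h0 | h0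
    · rw [hm, ← h0]; linarith
    · have : 0 ≤ (1 - t) * l := mul_nonneg (by linarith [ht.2]) hl.le
      have : 0 < t * l' := mul_pos h0 hl'
      linarith
  have hml : m ≤ l + l' := by nlinarith [ht.1, ht.2]
  have e : l • (F x - y) + t • (l' • (F x - y) - l • (F x - y)) =
      m • (f x - y) + m • (F x - f x) := by
    rw [hm]; module
  rw [e]
  have h2 := hclose m hmpos hml x
  have h3 : ‖m • (f x - y)‖ ≤ ‖m • (f x - y) + m • (F x - f x)‖ + ‖m • (F x - f x)‖ := by
    have := norm_sub_le (m • (f x - y) + m • (F x - f x)) (m • (F x - f x))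
    simpa using this
  rw [norm_smul, norm_smul, Real.norm_of_nonneg hmpos.le] at h3
  have h4 : 1 ≤ l * ‖f x - y‖ := by
    linarith [h.close x hx, norm_nonneg (g x - l • (f x - y))]
  have h5 : 1 ≤ l' * ‖f x - y‖ := by
    linarith [h'.close x hx, norm_nonneg (g' x - l' • (f x - y))]
  have h6 : 1 ≤ m * ‖f x - y‖ := by
    have : m * ‖f x - y‖ = (1 - t) * (l * ‖f x - y‖) + t * (l' * ‖f x - y‖) := by rw [hm]; ring
    rw [this]
    nlinarith [ht.1, ht.2]
  linarith

open Classical in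
/-- The degree of `f` over `y`, weighted by `c`; it is zero when `y` lies in the image of `K`. -/
noncomputable def pushCount (K : Set (ι → ℝ)) (f : (ι → ℝ) → (ι → ℝ)) (c : (ι → ℝ) → ℝ)
    (y : ι → ℝ) : ℝ :=
  if h : ∃ p : ℝ × ((ι → ℝ) → (ι → ℝ)), IsApprox K f y p.1 p.2 then zeroCount c h.choose.2 else 0

lemma pushCount_eq {K : Set (ι → ℝ)} {c : (ι → ℝ) → ℝ} (hK : IsCompact K)
    (hc : IsLocConstOff K c) {f g : (ι → ℝ) → (ι → ℝ)} (hf : Continuous f) {y : ι → ℝ}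
    {l : ℝ} (h : IsApprox K f y l g) : pushCount K f c y = zeroCount c g := by
  have hex : ∃ p : ℝ × ((ι → ℝ) → (ι → ℝ)), IsApprox K f y p.1 p.2 := ⟨(l, g), h⟩
  rw [pushCount, dif_pos hex]
  exact zeroCount_eq_of_isApprox hK hc hf hex.choose_spec h

lemma pushCount_eq_zero {K : Set (ι → ℝ)} (c : (ι → ℝ) → ℝ) {f : (ι → ℝ) → (ι → ℝ)} {y : ι → ℝ}
    (hy : y ∈ f '' K) : pushCount K f c y = 0 := by
  rw [pushCount, dif_neg]
  rintro ⟨⟨l, g⟩, h⟩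
  obtain ⟨x, hx, rfl⟩ := hy
  have := h.close x hx
  simp only [sub_self, smul_zero, sub_zero, norm_zero, mul_zero] at this
  linarith [norm_nonneg (g x)]

lemma pushCount_smul (K : Set (ι → ℝ)) (f : (ι → ℝ) → (ι → ℝ)) (a : ℝ) (c : (ι → ℝ) → ℝ) :
    pushCount K f (fun x => a * c x) = fun y => a * pushCount K f c y := by
  funext y
  unfold pushCount
  split_ifs with h
  · exact zeroCount_smul _ _ _
  · simp

lemma isLocConstOff_pushCount {K : Set (ι → ℝ)} {c : (ι → ℝ) → ℝ} (hK : IsCompact K)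
    (hc : IsLocConstOff K c) {f : (ι → ℝ) → (ι → ℝ)} (hf : Continuous f) :
    IsLocConstOff (f '' K) (pushCount K f c) := by
  refine ⟨fun y hy => pushCount_eq_zero c hy, fun y hy => ?_, ?_⟩
  · obtain ⟨l, g, h, h2⟩ := exists_isApprox hK hf hy
    have hl := h.pos
    filter_upwards [Metric.ball_mem_nhds y (ε := 1 / (2 * l)) (by positivity)] with z hz
    rw [pushCount_eq hK hc hf h]
    refine pushCount_eq hK hc hf (l := l) ⟨h.smooth, hl, fun x hx => ?_⟩
    have hz' : l * ‖y - z‖ ≤ 1 / 2 := by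
      rw [Metric.mem_ball, dist_comm, dist_eq_norm, lt_div_iff₀ (by positivity)] at hz
      linarith
    have h3 : ‖g x - l • (f x - z)‖ ≤ ‖g x - l • (f x - y)‖ + l * ‖y - z‖ := by
      rw [show g x - l • (f x - z) = (g x - l • (f x - y)) - l • (y - z) by module]
      refine (norm_sub_le _ _).trans ?_
      rw [norm_smul, Real.norm_of_nonneg hl.le]
    have h4 : ‖f x - y‖ ≤ ‖f x - z‖ + ‖y - z‖ := by
      rw [show f x - y = (f x - z) - (y - z) by module]
      exact norm_sub_le _ _
    nlinarith [h2 x hx]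
  · obtain ⟨F, hF, hFf⟩ := exists_smooth_close hf one_pos
    obtain ⟨R, hR⟩ := hc.bounded_support
    obtain ⟨M, hM⟩ := (isCompact_closedBall (0 : ι → ℝ) R |>.union hK).exists_bound_of_continuousOn
      hF.continuous.continuousOn
    refine ⟨M + 3, fun y hy => ?_⟩
    have hfar : ∀ x, ‖F x‖ ≤ M → 3 < ‖F x - y‖ := fun x hx => by
      have := norm_sub_norm_le y (F x)
      rw [norm_sub_rev] at this
      linarith
    rw [pushCount_eq hK hc hf (l := 1) (g := fun x => F x - y)]
    · refine integral_eq_zero_of_ae (Eventually.of_forall fun x => ?_)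
      by_cases hx : R < ‖x‖
      · simp [hR x hx]
      · have := hfar x (hM x (Or.inl (by simpa using hx)))
        simp [kern_eq_zero (x := F x - y) (by linarith)]
    · refine ⟨hF.sub contDiff_const, one_pos, fun x hx => ?_⟩
      have h1 := hfar x (hM x (Or.inr hx))
      have h2 := hFf x
      have h3 : ‖F x - y‖ ≤ ‖f x - y‖ + ‖F x - f x‖ := by
        rw [show F x - y = (f x - y) + (F x - f x) by module]
        exact norm_add_le _ _
      simp only [one_smul, sub_sub_sub_cancel_right, one_mul]
      linarith

end Degree

section Composition

variable {ι : Type*} [Fintype ι]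

lemma integral_comp_kern (H : (ι → ℝ) → ℝ) (p : ι → ℝ) {s : ℝ} (hs : 0 < s) :
    ∫ y, s⁻¹ ^ Fintype.card ι * (H y * kern ι (s⁻¹ • (p - y))) =
      ∫ w, H (p - s • w) * kern ι w := by
  have h1 := integral_sub_left_eq_self
    (fun y => s⁻¹ ^ Fintype.card ι * (H y * kern ι (s⁻¹ • (p - y)))) volume p
  have h2 := Measure.integral_comp_smul (volume : Measure (ι → ℝ))
    (fun w => H (p - s • w) * kern ι w) s⁻¹
  rw [← h1, integral_const_mul]
  simp only [sub_sub_cancel]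
  simp only [smul_smul, mul_inv_cancel₀ hs.ne', one_smul] at h2
  rw [h2, Module.finrank_fintype_fun_eq_card, abs_of_pos (by positivity), smul_eq_mul,
    ← mul_assoc, mul_inv_cancel₀ (by positivity), one_mul]

variable [DecidableEq ι]

lemma jacobian_smul_sub {F : (ι → ℝ) → (ι → ℝ)} (hF : Differentiable ℝ F) (m : ℝ) (y x : ι → ℝ) :
    jacobian (fun x => m • (F x - y)) x = m ^ Fintype.card ι * jacobian F x := by
  have h : fderiv ℝ (fun x => m • (F x - y)) x = m • fderiv ℝ F x :=
    (((hF x).hasFDerivAt.sub_const y).const_smul m).fderiv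
  have h2 : partials (fun x => m • (F x - y)) x = m • partials F x := by
    funext i
    simp [partials, h]
  rw [jacobian, jacobian, h2, detRow_apply, detRow_apply, ← Matrix.det_smul]
  rfl

lemma jacobian_id (x : ι → ℝ) : jacobian (fun x => x) x = 1 := by
  have h : Matrix.of (partials (fun x : ι → ℝ => x) x) = 1 := by
    ext i j
    simp [partials, Matrix.one_apply, Pi.single_apply, eq_comm]
  rw [jacobian, detRow_apply, h, Matrix.det_one]

lemma integral_pushCount_mul {K : Set (ι → ℝ)} {c : (ι → ℝ) → ℝ} (hK : IsCompact K)
    (hc : IsLocConstOff K c) {f F : (ι → ℝ) → (ι → ℝ)} (hf : Continuous f)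
    (hF : ContDiff ℝ ∞ F) {δ : ℝ} (hδ : 0 < δ) (hFf : ∀ x ∈ K, ‖F x - f x‖ ≤ δ / 4)
    {H : (ι → ℝ) → ℝ} (hH : Continuous H) (hHK : ∀ y, H y ≠ 0 → ∀ x ∈ K, δ ≤ ‖f x - y‖) :
    ∫ y, pushCount K f c y * H y = ∫ x, c x * (H (F x) * jacobian F x) := by
  set U : Set (ι → ℝ) := ⋃ k ∈ K, {x | ‖F x - f k‖ < δ / 2} with hUdef
  have hU : IsOpen U := isOpen_biUnion fun k _ =>
    isOpen_lt (by have := hF.continuous; fun_prop) continuous_const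
  have hKU : K ⊆ U := fun x hx => mem_biUnion hx (show ‖F x - f x‖ < δ / 2 by linarith [hFf x hx])
  have hUfar : ∀ x ∈ U, ∀ y, H y ≠ 0 → δ / 2 ≤ ‖F x - y‖ := by
    intro x hx y hy
    obtain ⟨k, hk, hxk⟩ := mem_iUnion₂.1 hx
    have h1 := hHK y hy k hk
    have h2 : ‖f k - y‖ ≤ ‖F x - y‖ + ‖F x - f k‖ := by
      rw [show f k - y = (F x - y) - (F x - f k) by module]
      exact norm_sub_le _ _
    have h3 : ‖F x - f k‖ < δ / 2 := hxk
    linarith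
  obtain ⟨χ, hχ, hχc, hχU⟩ := hc.exists_cutoff hK.isClosed hU hKU
  have hFc := hF.continuous
  have hJ : Continuous (jacobian F) := (contDiff_jacobian hF).continuous
  have hker : Continuous (kern ι) := contDiff_kern.continuous
  have hpt : ∀ s : ℝ, 0 < s → s ≤ δ / 4 → ∀ y, pushCount K f c y * H y =
      ∫ x, χ x * jacobian F x * (s⁻¹ ^ Fintype.card ι * (H y * kern ι (s⁻¹ • (F x - y)))) := by
    intro s hs hsδ y
    by_cases hy : H y = 0
    · simp [hy]
    have hsi : s⁻¹ * s = 1 := inv_mul_cancel₀ hs.ne'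
    have hsi0 : 0 < s⁻¹ := by positivity
    rw [pushCount_eq hK hc hf (l := s⁻¹) (g := fun x => s⁻¹ • (F x - y)), zeroCount,
      ← integral_mul_const]
    · refine integral_congr_ae (Eventually.of_forall fun x => ?_)
      simp only [jacobian_smul_sub (hF.differentiable (by simp))]
      by_cases hx : x ∈ U
      · have h1 := hUfar x hx y hy
        have : kern ι (s⁻¹ • (F x - y)) = 0 := by
          refine kern_eq_zero ?_
          rw [norm_smul, Real.norm_of_nonneg hsi0.le]
          nlinarith
        simp [this]
      · rw [(hχU x hx).1]; ring
    · refine ⟨(contDiff_const (c := s⁻¹)).fun_smul (hF.sub contDiff_const), hsi0, fun x hx => ?_⟩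
      rw [show s⁻¹ • (F x - y) - s⁻¹ • (f x - y) = s⁻¹ • (F x - f x) by module, norm_smul,
        Real.norm_of_nonneg hsi0.le]
      have h1 := hHK y hy x hx
      have h2 := hFf x hx
      nlinarith
  obtain ⟨M, hM⟩ := hχc.isCompact.exists_bound_of_continuousOn hFc.continuousOn
  set Ψ : ℝ → ℝ := fun s => ∫ x in tsupport χ, χ x * jacobian F x *
    ∫ w in Metric.closedBall (0 : ι → ℝ) 1, H (F x - s • w) * kern ι w with hΨ
  have hin : ∀ (s : ℝ) x, ∫ w in Metric.closedBall (0 : ι → ℝ) 1, H (F x - s • w) * kern ι w =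
      ∫ w, H (F x - s • w) * kern ι w := fun s x =>
    setIntegral_eq_integral_of_forall_compl_eq_zero fun w hw => by
      rw [kern_eq_zero, mul_zero]
      simp only [Metric.mem_closedBall, dist_zero_right, not_le] at hw
      linarith
  have hΨ' : ∀ s : ℝ, Ψ s = ∫ x, χ x * jacobian F x * ∫ w, H (F x - s • w) * kern ι w := by
    intro s
    simp only [hΨ, hin]
    exact setIntegral_eq_integral_of_forall_compl_eq_zero fun x hx => by
      simp [image_eq_zero_of_notMem_tsupport hx]
  have hΨc : Continuous Ψ := by
    have h1 : Continuous fun p : ℝ × (ι → ℝ) =>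
        ∫ w in Metric.closedBall (0 : ι → ℝ) 1, H (F p.2 - p.1 • w) * kern ι w :=
      continuous_parametric_integral_of_continuous
        (f := fun (p : ℝ × (ι → ℝ)) w => H (F p.2 - p.1 • w) * kern ι w)
        (by unfold Function.uncurry; fun_prop) (isCompact_closedBall _ _)
    refine continuous_parametric_integral_of_continuous
      (f := fun s x => χ x * jacobian F x *
        ∫ w in Metric.closedBall (0 : ι → ℝ) 1, H (F x - s • w) * kern ι w) ?_ hχc.isCompact
    have := hχ.continuous
    exact ((this.comp continuous_snd).mul (hJ.comp continuous_snd)).mul h1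
  have hΨs : ∀ s : ℝ, 0 < s → s ≤ δ / 4 → Ψ s = ∫ y, pushCount K f c y * H y := by
    intro s hs hsδ
    simp_rw [hpt s hs hsδ]
    rw [integral_integral_swap_of_hasCompactSupport]
    · rw [hΨ']
      refine integral_congr_ae (Eventually.of_forall fun x => ?_)
      simp only
      rw [integral_const_mul, integral_comp_kern H (F x) hs]
    · have := hχ.continuous
      unfold Function.uncurry
      fun_prop
    · refine HasCompactSupport.intro
        ((isCompact_closedBall (0 : ι → ℝ) (M + s)).prod hχc.isCompact) fun p hp => ?_
      simp only [Function.uncurry]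
      by_cases h2 : p.2 ∈ tsupport χ
      · have h1 : ¬ ‖p.1‖ ≤ M + s := fun h => hp ⟨by simpa using h, h2⟩
        have h3 := hM _ h2
        have h4 := norm_sub_norm_le p.1 (F p.2)
        rw [norm_sub_rev] at h4
        rw [kern_eq_zero (x := s⁻¹ • (F p.2 - p.1))]
        · simp
        · rw [norm_smul, Real.norm_of_nonneg (by positivity)]
          have : s⁻¹ * s ≤ s⁻¹ * ‖F p.2 - p.1‖ := by gcongr; linarith
          rw [inv_mul_cancel₀ hs.ne'] at this
          linarith
      · simp [image_eq_zero_of_notMem_tsupport h2]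
  have hlim : Tendsto Ψ (𝓝[>] 0) (𝓝 (Ψ 0)) := hΨc.continuousAt.continuousWithinAt
  have hlim' : Tendsto Ψ (𝓝[>] 0) (𝓝 (∫ y, pushCount K f c y * H y)) := by
    refine tendsto_const_nhds.congr' ?_
    filter_upwards [Ioc_mem_nhdsGT (show (0 : ℝ) < δ / 4 by positivity)] with s hs
    exact (hΨs s hs.1 hs.2).symm
  rw [tendsto_nhds_unique hlim' hlim, hΨ']
  refine integral_congr_ae (Eventually.of_forall fun x => ?_)
  simp only [zero_smul, sub_zero, integral_const_mul, integral_kern, mul_one]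
  by_cases hx : x ∈ U
  · have : H (F x) = 0 := by
      by_contra h
      have := hUfar x hx _ h
      simp only [sub_self, norm_zero] at this
      linarith
    simp [this]
  · rw [(hχU x hx).1]; ring

lemma pushCount_comp {K : Set (ι → ℝ)} {c : (ι → ℝ) → ℝ} (hK : IsCompact K)
    (hc : IsLocConstOff K c) {f g : (ι → ℝ) → (ι → ℝ)} (hf : Continuous f) (hg : Continuous g)
    {z : ι → ℝ} (hz : z ∉ g '' (f '' K)) :
    pushCount (f '' K) g (pushCount K f c) z = pushCount K (g ∘ f) c z := by
  have hL : IsCompact (f '' K) := hK.image hf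
  obtain ⟨l, G, hG, hG2⟩ := exists_isApprox hL hg hz
  have hGc := hG.smooth.continuous
  obtain ⟨δ, hδ, hδG⟩ : ∃ δ > 0, ∀ x ∈ K, ∀ y, ‖y - f x‖ < δ → ‖G y - G (f x)‖ < 1 := by
    have hu := (hL.cthickening (r := 1)).uniformContinuousOn_of_continuous hGc.continuousOn
    obtain ⟨δ, hδ, h⟩ := Metric.uniformContinuousOn_iff.1 hu 1 one_pos
    refine ⟨min δ 1, by positivity, fun x hx y hy => ?_⟩
    have hfx : f x ∈ f '' K := mem_image_of_mem f hx
    rw [← dist_eq_norm] at hy ⊢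
    exact h y (Metric.mem_cthickening_of_dist_le y (f x) 1 _ hfx (hy.le.trans (min_le_right _ _)))
      (f x) (Metric.self_subset_cthickening _ hfx) (hy.trans_le (min_le_left _ _))
  obtain ⟨F, hF, hFf⟩ := exists_smooth_close hf (ε := δ / 4) (by positivity)
  have hl := hG.pos
  have happ : IsApprox K (g ∘ f) z l (G ∘ F) := by
    refine ⟨hG.smooth.comp hF, hl, fun x hx => ?_⟩
    have h1 := hG2 (f x) (mem_image_of_mem f hx)
    have h2 := hδG x hx (F x) (by linarith [hFf x])
    have h3 : ‖G (F x) - l • (g (f x) - z)‖ ≤ ‖G (F x) - G (f x)‖ +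
        ‖G (f x) - l • (g (f x) - z)‖ := by
      rw [show G (F x) - l • (g (f x) - z) = (G (F x) - G (f x)) +
        (G (f x) - l • (g (f x) - z)) by module]
      exact norm_add_le _ _
    simp only [Function.comp_apply]
    linarith
  rw [pushCount_eq hL (isLocConstOff_pushCount hK hc hf) hg hG,
    pushCount_eq hK hc (hg.comp hf) happ, zeroCount,
    integral_pushCount_mul hK hc hf hF hδ (fun x _ => (hFf x).le)
      (H := fun y => kern ι (G y) * jacobian G y)
      ((contDiff_kern.continuous.comp hGc).mul (contDiff_jacobian hG.smooth).continuous)]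
  · refine integral_congr_ae (Eventually.of_forall fun x => ?_)
    simp only [Function.comp_apply, jacobian_comp (hG.smooth.differentiable (by simp))
      (hF.differentiable (by simp))]
    ring
  · intro y hy x hx
    by_contra! hlt
    rw [norm_sub_rev] at hlt
    refine hy ?_
    rw [kern_eq_zero, zero_mul]
    have h1 := hδG x hx y hlt
    have h2 := hG2 (f x) (mem_image_of_mem f hx)
    have h3 : ‖l • (g (f x) - z)‖ ≤ ‖G y‖ + ‖G y - G (f x)‖ + ‖G (f x) - l • (g (f x) - z)‖ := by
      have e : l • (g (f x) - z) =
          G y - (G y - G (f x)) - (G (f x) - l • (g (f x) - z)) := by module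
      conv_lhs => rw [e]
      exact (norm_sub_le _ _).trans (add_le_add_left (norm_sub_le _ _) _)
    rw [norm_smul, Real.norm_of_nonneg hl.le] at h3
    linarith

lemma pushCount_eq_self {K : Set (ι → ℝ)} {c : (ι → ℝ) → ℝ} (hK : IsCompact K)
    (hc : IsLocConstOff K c) {h : (ι → ℝ) → (ι → ℝ)} (hh : Continuous h)
    (hid : ∀ x ∈ K, h x = x) {z : ι → ℝ} (hz : z ∉ K) : pushCount K h c z = c z := by
  obtain ⟨δ, hδ, hδc⟩ := Metric.eventually_nhds_iff.1
    ((hc.eventually_eq z hz).and (hK.isClosed.isOpen_compl.eventually_mem hz))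
  have happ : IsApprox K h z δ⁻¹ fun x => δ⁻¹ • (x - z) := by
    refine ⟨(contDiff_const (c := δ⁻¹)).fun_smul (contDiff_id.sub contDiff_const), by positivity,
      fun x hx => ?_⟩
    have : δ ≤ ‖x - z‖ := by
      by_contra! hlt
      exact (hδc (by rwa [dist_eq_norm])).2 hx
    rw [hid x hx, sub_self, norm_zero, zero_add]
    calc 1 = δ⁻¹ * δ := (inv_mul_cancel₀ hδ.ne').symm
      _ ≤ _ := by gcongr
  rw [pushCount_eq hK hc hh happ, zeroCount]
  have e : ∀ x, c x * (kern ι (δ⁻¹ • (x - z)) * jacobian (fun x => δ⁻¹ • (x - z)) x) =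
      c z * (δ⁻¹ ^ Fintype.card ι * (1 * kern ι (δ⁻¹ • (x - z)))) := by
    intro x
    rw [jacobian_smul_sub (F := fun x => x) differentiable_id, jacobian_id]
    by_cases hx : ‖x - z‖ < δ
    · rw [(hδc (by rwa [dist_eq_norm])).1]; ring
    · rw [kern_eq_zero (x := δ⁻¹ • (x - z))]
      · ring
      · rw [norm_smul, Real.norm_of_nonneg (by positivity)]
        have : δ⁻¹ * δ ≤ δ⁻¹ * ‖x - z‖ := by gcongr; linarith
        rw [inv_mul_cancel₀ hδ.ne'] at this
        linarith
  simp_rw [e]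
  rw [integral_const_mul, integral_const_mul]
  have h2 := Measure.integral_comp_smul (volume : Measure (ι → ℝ)) (kern ι) δ⁻¹
  have h3 := integral_sub_right_eq_self (fun x => kern ι (δ⁻¹ • x)) (μ := volume) z
  simp only [one_mul]
  rw [h3, h2, Module.finrank_fintype_fun_eq_card, abs_of_pos (by positivity), smul_eq_mul,
    integral_kern, mul_one, mul_inv_cancel₀ (by positivity), mul_one]

/-- A left inverse of `f` on `K` recovers the weight `c` from its push-forward along `f`. -/
theorem pushCount_pushCount {K : Set (ι → ℝ)} {c : (ι → ℝ) → ℝ} (hK : IsCompact K)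
    (hc : IsLocConstOff K c) {f g : (ι → ℝ) → (ι → ℝ)} (hf : Continuous f) (hg : Continuous g)
    (hgf : ∀ x ∈ K, g (f x) = x) : pushCount (f '' K) g (pushCount K f c) = c := by
  have him : g '' (f '' K) = K := by
    rw [image_image]
    exact (image_congr hgf).trans (image_id' K)
  funext z
  by_cases hz : z ∈ K
  · rw [hc.zero_on z hz, pushCount_eq_zero _ (by rwa [him])]
  · rw [pushCount_comp hK hc hf hg (by rwa [him]),
      pushCount_eq_self hK hc (hg.comp hf) hgf hz]

end Composition

section JordanBrouwer

variable {ι : Type*} [Fintype ι]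

lemma IsLocConstOff.eq_of_isPreconnected {K D : Set (ι → ℝ)} {c : (ι → ℝ) → ℝ}
    (hc : IsLocConstOff K c) (hD : IsPreconnected D) (hDK : Disjoint D K) {x y : ι → ℝ}
    (hx : x ∈ D) (hy : y ∈ D) : c x = c y := by
  by_contra hne
  have h1 : IsOpen {z | ∀ᶠ w in 𝓝 z, c w = c x} := isOpen_setOfPred_eventually_nhds
  have h2 : IsOpen {z | ∀ᶠ w in 𝓝 z, c w ≠ c x} := isOpen_setOfPred_eventually_nhds
  obtain ⟨z, -, hz1, hz2⟩ := hD _ _ h1 h2 (fun z hz => by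
    have hloc := hc.eventually_eq z (hDK.notMem_of_mem_left hz)
    by_cases h : c z = c x
    · exact Or.inl (by simpa [h] using hloc)
    · exact Or.inr (hloc.mono fun w hw => by rwa [hw]))
    ⟨x, hx, hc.eventually_eq x (hDK.notMem_of_mem_left hx)⟩
    ⟨y, hy, (hc.eventually_eq y (hDK.notMem_of_mem_left hy)).mono fun w hw => by
      rw [hw]; exact fun h => hne h.symm⟩
  exact hz2.self_of_nhds hz1.self_of_nhds

lemma isLocConstOff_indicator {K W W' : Set (ι → ℝ)} (hW : IsOpen W) (hW' : IsOpen W')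
    (hd : Disjoint W W') (hcov : Kᶜ ⊆ W ∪ W') (hWK : Disjoint W K) (hb : ∃ R, ∀ x ∈ W, ‖x‖ ≤ R) :
    IsLocConstOff K (W.indicator fun _ => 1) := by
  refine ⟨fun x hx => indicator_of_notMem (hWK.notMem_of_mem_right hx) _, fun x hx => ?_, ?_⟩
  · rcases hcov hx with h | h
    · filter_upwards [hW.mem_nhds h] with y hy
      simp [h, hy]
    · filter_upwards [hW'.mem_nhds h] with y hy
      simp [hd.notMem_of_mem_right h, hd.notMem_of_mem_right hy]
  · obtain ⟨R, hR⟩ := hb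
    exact ⟨R, fun x hx => indicator_of_notMem (fun h => by linarith [hR x h]) _⟩

lemma IsLocConstOff.smul_eq_smul {K : Set (ι → ℝ)} {c : (ι → ℝ) → ℝ} (hc : IsLocConstOff K c)
    {x : ι → ℝ} {I : Set ℝ} (hI : IsPreconnected I) (hIK : ∀ t ∈ I, t • x ∉ K) {s t : ℝ}
    (hs : s ∈ I) (ht : t ∈ I) : c (s • x) = c (t • x) :=
  hc.eq_of_isPreconnected (D := (fun t : ℝ => t • x) '' I)
    (hI.image _ (by fun_prop : Continuous fun t : ℝ => t • x).continuousOn)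
    (disjoint_left.2 fun _ ⟨r, hr, h⟩ => h ▸ hIK r hr)
    (mem_image_of_mem _ hs) (mem_image_of_mem _ ht)

variable (ι) in
/-- The Euclidean unit sphere inside `ι → ℝ`. -/
def euclSphere : Set (ι → ℝ) := {x | ‖WithLp.toLp 2 x‖ = 1}

lemma norm_toLp_smul (t : ℝ) (x : ι → ℝ) : ‖WithLp.toLp 2 (t • x)‖ = |t| * ‖WithLp.toLp 2 x‖ := by
  rw [WithLp.toLp_smul, norm_smul, Real.norm_eq_abs]

lemma continuous_norm_toLp : Continuous fun x : ι → ℝ => ‖WithLp.toLp 2 x‖ :=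
  (PiLp.continuous_toLp 2 _).norm

lemma IsLocConstOff.eq_zero_of_ray {L : Set (ι → ℝ)} (hL : L ⊆ euclSphere ι) {c : (ι → ℝ) → ℝ}
    (hc : IsLocConstOff L c) {x : ι → ℝ} (hx : 1 ≤ ‖WithLp.toLp 2 x‖) : c x = 0 := by
  by_cases hxL : x ∈ L
  · exact hc.zero_on x hxL
  obtain ⟨R, hR⟩ := hc.bounded_support
  have hx0 : 0 < ‖x‖ := by
    rw [norm_pos_iff]
    rintro rfl
    norm_num at hx
  have h : ∀ t ∈ Ici (1 : ℝ), t • x ∉ L := by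
    intro t ht htL
    have h1 : ‖WithLp.toLp 2 (t • x)‖ = 1 := hL htL
    rw [norm_toLp_smul, abs_of_pos (by linarith [mem_Ici.1 ht])] at h1
    have h2 : t = 1 := le_antisymm (by nlinarith [mem_Ici.1 ht]) ht
    rw [h2, one_smul] at htL
    exact hxL htL
  have hs : 1 ≤ 1 + |R| / ‖x‖ := by
    have : 0 ≤ |R| / ‖x‖ := by positivity
    linarith
  have := hc.smul_eq_smul isPreconnected_Ici h (self_mem_Ici) (mem_Ici.2 hs)
  rw [one_smul] at this
  rw [this]
  refine hR _ ?_
  rw [norm_smul, Real.norm_of_nonneg (by linarith), add_mul, div_mul_cancel₀ _ hx0.ne']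
  linarith [le_abs_self R]

lemma IsLocConstOff.eq_apply_zero {L : Set (ι → ℝ)} (hL : L ⊆ euclSphere ι) {c : (ι → ℝ) → ℝ}
    (hc : IsLocConstOff L c) {x : ι → ℝ} (hx : ‖WithLp.toLp 2 x‖ ≤ 1) (hxL : x ∉ L) :
    c x = c 0 := by
  have h : ∀ t ∈ Icc (0 : ℝ) 1, t • x ∉ L := by
    intro t ht htL
    have h1 : ‖WithLp.toLp 2 (t • x)‖ = 1 := hL htL
    rw [norm_toLp_smul, abs_of_nonneg ht.1] at h1
    have h2 : t = 1 := le_antisymm ht.2 (by nlinarith [ht.1, ht.2])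
    rw [h2, one_smul] at htL
    exact hxL htL
  have := hc.smul_eq_smul isPreconnected_Icc h (s := 1) (t := 0) (by simp) (by simp)
  simpa using this

lemma IsLocConstOff.eq_zero_of_ssubset {L : Set (ι → ℝ)} (hL : L ⊂ euclSphere ι) {c : (ι → ℝ) → ℝ}
    (hc : IsLocConstOff L c) : c = 0 := by
  obtain ⟨p, hp, hpL⟩ := exists_of_ssubset hL
  have h0 : c 0 = 0 := by
    rw [← hc.eq_apply_zero hL.subset (le_of_eq hp) hpL]
    exact hc.eq_zero_of_ray hL.subset (ge_of_eq hp)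
  funext x
  rcases le_total 1 ‖WithLp.toLp 2 x‖ with h | h
  · exact hc.eq_zero_of_ray hL.subset h
  · by_cases hx : x ∈ L
    · exact hc.zero_on x hx
    · rw [hc.eq_apply_zero hL.subset h hx, h0]; rfl

variable (ι) in
/-- The indicator function of the open Euclidean unit ball. -/
noncomputable def ballIndicator : (ι → ℝ) → ℝ :=
  {x : ι → ℝ | ‖WithLp.toLp 2 x‖ < 1}.indicator fun _ => 1

lemma isLocConstOff_ballIndicator : IsLocConstOff (euclSphere ι) (ballIndicator ι) := by
  refine isLocConstOff_indicator (W' := {x | 1 < ‖WithLp.toLp 2 x‖})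
    (isOpen_lt continuous_norm_toLp continuous_const)
    (isOpen_lt continuous_const continuous_norm_toLp)
    (disjoint_left.2 fun x h1 h2 => lt_asymm (mem_ofPred.1 h1) (mem_ofPred.1 h2))
    (fun x hx => lt_or_gt_of_ne hx)
    (disjoint_left.2 fun x h1 h2 => h1.ne h2) ⟨1, fun x hx => ?_⟩
  refine (pi_norm_le_iff_of_nonneg zero_le_one).2 fun i => ?_
  exact (PiLp.norm_apply_le (WithLp.toLp 2 x) i).trans (le_of_lt hx)

lemma IsLocConstOff.eq_smul_ballIndicator {c : (ι → ℝ) → ℝ} (hc : IsLocConstOff (euclSphere ι) c) :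
    c = fun x => c 0 * ballIndicator ι x := by
  funext x
  rcases le_or_gt 1 ‖WithLp.toLp 2 x‖ with h | h
  · rw [hc.eq_zero_of_ray subset_rfl h]
    simp [ballIndicator, h]
  · rw [hc.eq_apply_zero subset_rfl h.le (fun h' => h.ne h')]
    simp [ballIndicator, h]

lemma ballIndicator_ne_zero : ballIndicator ι ≠ 0 := fun h => by
  have := congrFun h 0
  simp [ballIndicator] at this

lemma isPreconnected_norm_gt (hι : 1 < Fintype.card ι) {R : ℝ} (hR : 0 ≤ R) :
    IsPreconnected {x : ι → ℝ | R < ‖x‖} := by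
  have h1 : IsPreconnected (Metric.sphere (0 : ι → ℝ) 1) :=
    isPreconnected_sphere (by rw [rank_fun']; exact_mod_cast hι) 0 1
  have h2 := (isPreconnected_Ioi (a := R)).prod h1
  have h3 := h2.image (fun p : ℝ × (ι → ℝ) => p.1 • p.2) (by fun_prop)
  convert h3 using 1
  ext x
  constructor
  · intro hx
    have hx' : R < ‖x‖ := hx
    refine ⟨(‖x‖, ‖x‖⁻¹ • x), ⟨hx, ?_⟩, ?_⟩
    · simp [norm_smul, (hR.trans_lt hx').ne']
    · simp [smul_smul, (hR.trans_lt hx').ne']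
  · rintro ⟨⟨t, y⟩, ⟨ht, hy⟩, rfl⟩
    have hy' : ‖y‖ = 1 := by simpa using hy
    have ht' : R < t := ht
    simp only [mem_ofPred_eq, norm_smul, hy', mul_one, Real.norm_eq_abs]
    exact ht'.trans_le (le_abs_self t)

variable [DecidableEq ι]

/-- **Jordan–Brouwer separation theorem** for a compact set `K` that `f` maps bijectively onto
the Euclidean unit sphere. -/
theorem exists_jordan_brouwer (hι : 1 < Fintype.card ι) {K : Set (ι → ℝ)} (hK : IsCompact K)
    {f g : (ι → ℝ) → (ι → ℝ)} (hf : Continuous f) (hg : Continuous g)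
    (hgf : ∀ x ∈ K, g (f x) = x) (hfK : f '' K = euclSphere ι) :
    ∃ A B : Set (ι → ℝ), IsOpen A ∧ IsOpen B ∧ Disjoint A B ∧ A ∪ B = Kᶜ ∧ IsPreconnected A ∧
      IsPreconnected B ∧ B.Nonempty ∧ (∃ R, ∀ x, R < ‖x‖ → x ∈ A) ∧ K ⊆ closure A ∧
      K ⊆ closure B := by
  have hS : IsCompact (euclSphere ι) := hfK ▸ hK.image hf
  have hgS : g '' euclSphere ι = K := by
    rw [← hfK, image_image]
    exact (image_congr hgf).trans (image_id' K)
  have hfg : ∀ y ∈ euclSphere ι, f (g y) = y := by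
    rw [← hfK]
    rintro _ ⟨x, hx, rfl⟩
    rw [hgf x hx]
  set b := pushCount (euclSphere ι) g (ballIndicator ι) with hb
  have hbK : IsLocConstOff K b := hgS ▸ isLocConstOff_pushCount hS isLocConstOff_ballIndicator hg
  have hb0 : b ≠ 0 := by
    intro h0
    have h1 := pushCount_pushCount hS isLocConstOff_ballIndicator hg hf hfg
    rw [hgS, ← hb, h0] at h1
    have h2 := pushCount_smul K f 0 0
    simp only [Pi.zero_apply, mul_zero, zero_mul] at h2
    refine ballIndicator_ne_zero (ι := ι) ?_
    rw [← h1]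
    exact h2
  have huniq : ∀ c, IsLocConstOff K c → ∃ a : ℝ, c = fun x => a * b x := by
    intro c hc
    have h1 := pushCount_pushCount hK hc hf hg hgf
    rw [hfK] at h1
    have h2 := (hfK ▸ isLocConstOff_pushCount hK hc hf :
      IsLocConstOff (euclSphere ι) (pushCount K f c)).eq_smul_ballIndicator
    refine ⟨pushCount K f c 0, ?_⟩
    rw [h2, pushCount_smul] at h1
    exact h1.symm
  have hproper : ∀ K' ⊂ K, IsClosed K' → ∀ c, IsLocConstOff K' c → c = 0 := by
    intro K' hK' hcl c hc
    have hcomp : IsCompact K' := hK.of_isClosed_subset hcl hK'.subset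
    have hss : f '' K' ⊂ euclSphere ι := by
      refine (ssubset_iff_subset_ne.2 ⟨hfK ▸ image_mono hK'.subset, fun h => hK'.ne ?_⟩)
      have hinj : InjOn f K := (LeftInvOn.injOn (f₁' := g) hgf)
      exact (hinj.image_eq_image_iff hK'.subset subset_rfl).1 (h.trans hfK.symm)
    have h1 := pushCount_pushCount hcomp hc hf hg fun x hx => hgf x (hK'.subset hx)
    have h2 := (isLocConstOff_pushCount hcomp hc hf).eq_zero_of_ssubset hss
    have h3 := pushCount_smul (f '' K') g 0 0
    simp only [Pi.zero_apply, mul_zero, zero_mul] at h3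
    rw [h2] at h1
    exact h1.symm.trans h3
  set B := {x | b x ≠ 0} with hB
  set A := {x | x ∉ K ∧ b x = 0} with hA
  have hBK : ∀ x ∈ B, x ∉ K := fun x hx hxK => hx (hbK.zero_on x hxK)
  have hBo : IsOpen B := by
    rw [isOpen_iff_eventually]
    intro x hx
    exact (hbK.eventually_eq x (hBK x hx)).mono fun y hy => by
      simp only [hB, mem_ofPred_eq, hy]; exact hx
  have hAo : IsOpen A := by
    rw [isOpen_iff_eventually]
    intro x hx
    filter_upwards [hbK.eventually_eq x hx.1, hK.isClosed.isOpen_compl.eventually_mem hx.1]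
      with y hy hy'
    exact ⟨hy', hy.trans hx.2⟩
  have hAB : Disjoint A B := disjoint_left.2 fun x h1 h2 => h2 h1.2
  have hcov : A ∪ B = Kᶜ := by
    ext x
    constructor
    · rintro (h | h)
      exacts [h.1, hBK x h]
    · intro h
      by_cases h0 : b x = 0
      exacts [Or.inl ⟨h, h0⟩, Or.inr h0]
  have hBne : B.Nonempty := by
    by_contra! h
    refine hb0 (funext fun x => ?_)
    by_contra hx
    exact (h ▸ (show x ∈ B from hx) : x ∈ (∅ : Set (ι → ℝ)))
  obtain ⟨R₀, hR₀⟩ : ∃ R, ∀ x ∈ B ∪ K, ‖x‖ ≤ R := by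
    obtain ⟨R₁, h1⟩ := hbK.bounded_support
    obtain ⟨R₂, h2⟩ := hK.isBounded.exists_norm_le
    refine ⟨max R₁ R₂, fun x hx => ?_⟩
    rcases hx with hx | hx
    · exact le_max_of_le_left (not_lt.1 fun h => hx (h1 x h))
    · exact le_max_of_le_right (h2 x hx)
  set R := max R₀ 0 with hR
  have hRA : ∀ x, R < ‖x‖ → x ∈ A := by
    intro x hx
    have hx' : x ∉ B ∪ K := fun h => by linarith [hR₀ x h, le_max_left R₀ 0]
    exact ⟨fun h => hx' (Or.inr h), by_contra fun h => hx' (Or.inl h)⟩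
  have hdich : ∀ W W' : Set (ι → ℝ), IsOpen W → IsOpen W' → Disjoint W W' → Kᶜ ⊆ W ∪ W' →
      Disjoint W K → (∃ R, ∀ x ∈ W, ‖x‖ ≤ R) → W = ∅ ∨ W = B := by
    intro W W' hW hW' hd hc hWK hbd
    obtain ⟨a, ha⟩ := huniq _ (isLocConstOff_indicator hW hW' hd hc hWK hbd)
    have hmem : ∀ x, x ∈ W ↔ a * b x ≠ 0 := by
      intro x
      rw [← congrFun ha x]
      by_cases hx : x ∈ W <;> simp [hx]
    by_cases ha0 : a = 0
    · left
      ext x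
      simp [hmem, ha0]
    · right
      ext x
      simp [hmem, ha0, hB]
  have hempty : ∀ O W W' : Set (ι → ℝ), IsOpen O → (∃ x ∈ K, x ∈ O) → IsOpen W → IsOpen W' →
      Disjoint W W' → (K \ O)ᶜ ⊆ W ∪ W' → Disjoint W (K \ O) → (∃ R, ∀ x ∈ W, ‖x‖ ≤ R) →
      W = ∅ := by
    rintro O W W' hO ⟨x, hxK, hxO⟩ hW hW' hd hc hWK hbd
    have h0 := hproper (K \ O) ⟨sdiff_subset, fun h => (h hxK).2 hxO⟩ (hK.isClosed.sdiff hO) _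
      (isLocConstOff_indicator hW hW' hd hc hWK hbd)
    ext y
    have := congrFun h0 y
    by_cases hy : y ∈ W <;> simp_all
  have hcovO : ∀ O : Set (ι → ℝ), (K \ O)ᶜ ⊆ A ∪ B ∪ O := by
    intro O x hx
    rw [hcov]
    by_cases hxO : x ∈ O
    · exact Or.inr hxO
    · exact Or.inl fun h => hx ⟨h, hxO⟩
  have hAu : ∀ u v : Set (ι → ℝ), IsOpen u → IsOpen v → A ⊆ u ∪ v → A ∩ (u ∩ v) = ∅ →
      {x : ι → ℝ | R < ‖x‖} ⊆ u → A ⊆ u := by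
    intro u v hu hv huv hd hRu
    have h1 := hdich (A ∩ v) (A ∩ u ∪ B) (hAo.inter hv) ((hAo.inter hu).union hBo) ?_ ?_ ?_ ?_
    · have h2 : A ∩ v = ∅ := by
        refine h1.resolve_right fun h => ?_
        obtain ⟨x, hx⟩ := hBne
        exact disjoint_left.1 hAB (h.symm ▸ hx : x ∈ A ∩ v).1 hx
      intro x hx
      refine (huv hx).resolve_right fun hxv => ?_
      exact (h2 ▸ (⟨hx, hxv⟩ : x ∈ A ∩ v) : x ∈ (∅ : Set (ι → ℝ)))
    · rw [disjoint_left]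
      rintro x ⟨hxA, hxv⟩ (⟨-, hxu⟩ | hxB)
      · exact (hd ▸ (⟨hxA, hxu, hxv⟩ : x ∈ A ∩ (u ∩ v)) : x ∈ (∅ : Set (ι → ℝ)))
      · exact disjoint_left.1 hAB hxA hxB
    · rw [← hcov]
      rintro x (hx | hx)
      · rcases huv hx with h | h
        exacts [Or.inr (Or.inl ⟨hx, h⟩), Or.inl ⟨hx, h⟩]
      · exact Or.inr (Or.inr hx)
    · exact disjoint_left.2 fun x hx hxK => hx.1.1 hxK
    · refine ⟨R, fun x hx => not_lt.1 fun h => ?_⟩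
      exact (hd ▸ (⟨hx.1, hRu h, hx.2⟩ : x ∈ A ∩ (u ∩ v)) : x ∈ (∅ : Set (ι → ℝ)))
  refine ⟨A, B, hAo, hBo, hAB, hcov, ?_, ?_, hBne, ⟨R, hRA⟩, ?_, ?_⟩
  · rw [isPreconnected_iff_subset_of_disjoint]
    intro u v hu hv huv hd
    have hE := isPreconnected_iff_subset_of_disjoint.1
      (isPreconnected_norm_gt hι (le_max_right R₀ 0)) u v hu hv
      (fun x hx => huv (hRA x hx))
      (subset_empty_iff.1 (hd ▸ inter_subset_inter_left _ fun x hx => hRA x hx))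
    rcases hE with h | h
    · exact Or.inl (hAu u v hu hv huv hd h)
    · exact Or.inr (hAu v u hv hu (union_comm u v ▸ huv) (inter_comm u v ▸ hd) h)
  · rw [isPreconnected_iff_subset_of_disjoint]
    intro u v hu hv huv hd
    have h1 := hdich (B ∩ u) (B ∩ v ∪ A) (hBo.inter hu) ((hBo.inter hv).union hAo) ?_ ?_ ?_ ?_
    · rcases h1 with h1 | h1
      · right
        intro x hx
        refine (huv hx).resolve_left fun hxu => ?_
        exact (h1 ▸ (⟨hx, hxu⟩ : x ∈ B ∩ u) : x ∈ (∅ : Set (ι → ℝ)))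
      · exact Or.inl (inter_eq_left.1 h1)
    · rw [disjoint_left]
      rintro x ⟨hxB, hxu⟩ (⟨-, hxv⟩ | hxA)
      · exact (hd ▸ (⟨hxB, hxu, hxv⟩ : x ∈ B ∩ (u ∩ v)) : x ∈ (∅ : Set (ι → ℝ)))
      · exact disjoint_left.1 hAB hxA hxB
    · rw [← hcov]
      rintro x (hx | hx)
      · exact Or.inr (Or.inr hx)
      · rcases huv hx with h | h
        exacts [Or.inl ⟨hx, h⟩, Or.inr (Or.inl ⟨hx, h⟩)]
    · exact disjoint_left.2 fun x hx hxK => hBK x hx.1 hxK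
    · exact ⟨R₀, fun x hx => hR₀ x (Or.inl hx.1)⟩
  · intro x hx
    rw [mem_closure_iff]
    intro O hO hxO
    by_contra hne
    rw [not_nonempty_iff_eq_empty] at hne
    have hOA : ∀ y ∈ O, y ∉ A := fun y hy hyA =>
      (hne ▸ (⟨hy, hyA⟩ : y ∈ O ∩ A) : y ∈ (∅ : Set (ι → ℝ)))
    have h1 := hempty O (B ∪ O) A hO ⟨x, hx, hxO⟩ (hBo.union hO) hAo ?_ ?_ ?_ ?_
    · exact (h1 ▸ (Or.inr hxO : x ∈ B ∪ O) : x ∈ (∅ : Set (ι → ℝ)))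
    · rw [disjoint_union_left]
      exact ⟨hAB.symm, disjoint_left.2 hOA⟩
    · exact (hcovO O).trans fun y hy => by
        rcases hy with (hy | hy) | hy
        exacts [Or.inr hy, Or.inl (Or.inl hy), Or.inl (Or.inr hy)]
    · rw [disjoint_left]
      rintro y (hy | hy) hy'
      exacts [hBK y hy hy'.1, hy'.2 hy]
    · refine ⟨R₀, fun y hy => hR₀ y ?_⟩
      rcases hy with hy | hy
      · exact Or.inl hy
      · by_cases hyK : y ∈ K
        · exact Or.inr hyK
        · have : y ∈ A ∪ B := hcov ▸ hyK
          exact Or.inl (this.resolve_left (hOA y hy))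
  · intro x hx
    rw [mem_closure_iff]
    intro O hO hxO
    by_contra hne
    rw [not_nonempty_iff_eq_empty] at hne
    have hOB : ∀ y ∈ O, y ∉ B := fun y hy hyB =>
      (hne ▸ (⟨hy, hyB⟩ : y ∈ O ∩ B) : y ∈ (∅ : Set (ι → ℝ)))
    have h1 := hempty O B (A ∪ O) hO ⟨x, hx, hxO⟩ hBo (hAo.union hO) ?_ ?_ ?_ ?_
    · exact hBne.ne_empty h1
    · rw [disjoint_union_right]
      exact ⟨hAB.symm, disjoint_right.2 hOB⟩
    · exact (hcovO O).trans fun y hy => by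
        rcases hy with (hy | hy) | hy
        exacts [Or.inr (Or.inl hy), Or.inl hy, Or.inr (Or.inr hy)]
    · exact disjoint_left.2 fun y hy hy' => hBK y hy hy'.1
    · exact ⟨R₀, fun y hy => hR₀ y (Or.inl hy)⟩

end JordanBrouwer

section Separation

lemma eq_of_integer_valued {E : Type*} [TopologicalSpace E] {S : Set E} (hS : IsPreconnected S)
    {m : E → ℝ} (hm : ContinuousOn m S) (hval : ∀ x ∈ S, ∃ n : ℤ, m x = n) {p q : E}
    (hp : p ∈ S) (hq : q ∈ S) : m p = m q := by
  have key : ∀ a ∈ S, ∀ b ∈ S, ¬ m a < m b := by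
    intro a ha b hb hlt
    obtain ⟨i, hi⟩ := hval a ha
    obtain ⟨j, hj⟩ := hval b hb
    have hij : i < j := by rw [hi, hj] at hlt; exact_mod_cast hlt
    have hij' : (i : ℝ) + 1 ≤ j := by exact_mod_cast hij
    obtain ⟨z, hz, hmz⟩ := hS.intermediate_value ha hb hm
      (show m a + 1 / 2 ∈ Icc (m a) (m b) by rw [hi, hj]; constructor <;> linarith)
    obtain ⟨l, hl⟩ := hval z hz
    rw [hl, hi] at hmz
    have h1 : (i : ℝ) < l := by linarith
    have h2 : (l : ℝ) < i + 1 := by linarith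
    have h1' : i < l := by exact_mod_cast h1
    have h2' : l < i + 1 := by exact_mod_cast h2
    omega
  exact le_antisymm (not_lt.1 (key q hq p hp)) (not_lt.1 (key p hp q hq))

lemma frontier_subset_compl_union {E : Type*} [TopologicalSpace E] {U V : Set E}
    (hU : IsOpen U) (hV : IsOpen V) (hUV : Disjoint U V) : frontier V ⊆ (U ∪ V)ᶜ := by
  rintro x hx (h | h)
  · exact disjoint_left.1 (hUV.closure_right hU) h (frontier_subset_closure hx)
  · rw [hV.frontier_eq] at hx
    exact hx.2 h

/-- Janiszewski's theorem for disjoint closed sets: if neither of `X`, `Y` separates `p` from `q`,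
then `X ∪ Y` does not. -/
lemma not_separated_of_disjoint {E : Type*} [TopologicalSpace E] [NormalSpace E]
    [SimplyConnectedSpace E] [LocallyPathConnectedSpace E] {X Y U V S T : Set E} (hX : IsClosed X)
    (hY : IsClosed Y) (hXY : Disjoint X Y) (hU : IsOpen U) (hV : IsOpen V) (hUV : Disjoint U V)
    (hcov : U ∪ V = (X ∪ Y)ᶜ) {p q : E} (hp : p ∈ U) (hq : q ∈ V) (hS : IsPreconnected S)
    (hT : IsPreconnected T) (hSX : Disjoint S X) (hTY : Disjoint T Y) (hpS : p ∈ S) (hqS : q ∈ S)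
    (hpT : p ∈ T) (hqT : q ∈ T) : False := by
  classical
  obtain ⟨φ, hφX, hφY, -⟩ := exists_continuous_zero_one_of_isClosed hX hY hXY
  have hfr : ∀ x ∈ frontier {x | x ∈ V}, x ∈ X ∪ Y := fun x hx => by
    have := frontier_subset_compl_union hU hV hUV hx
    rwa [hcov, compl_compl] at this
  have hperiod : ((1 : ℝ) : AddCircle (1 : ℝ)) = 0 := AddCircle.coe_period 1
  have hcont : Continuous fun x => if x ∈ V then ((φ x : ℝ) : AddCircle (1 : ℝ)) else 0 := by
    refine Continuous.if (fun x hx => ?_) ((AddCircle.continuous_mk' 1).comp φ.continuous)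
      continuous_const
    rcases hfr x hx with h | h
    · rw [hφX h]; simp
    · rw [hφY h]; simp
  have hcov' := AddCircle.isCoveringMap_coe (1 : ℝ)
  have hpV : p ∉ V := disjoint_left.1 hUV hp
  obtain ⟨θ, ⟨-, hθ⟩, -⟩ := hcov'.existsUnique_continuousMap_lifts
    ⟨_, hcont⟩ p 0 (by simp [hpV])
  have hθ' : ∀ x, ((θ x : ℝ) : AddCircle (1 : ℝ)) =
      if x ∈ V then ((φ x : ℝ) : AddCircle (1 : ℝ)) else 0 :=
    fun x => congrFun hθ x
  have hval : ∀ a : ℝ, (a : AddCircle (1 : ℝ)) = 0 → ∃ n : ℤ, a = n := by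
    intro a ha
    obtain ⟨n, hn⟩ := (AddCircle.coe_eq_zero_iff 1).1 ha
    exact ⟨n, by simpa using hn.symm⟩
  have h1 := eq_of_integer_valued hT (m := fun x => θ x - if x ∈ V then φ x else 0)
    (θ.continuous.continuousOn.sub (ContinuousOn.if (fun x hx => by
      rcases hfr x hx.2 with h | h
      · exact hφX h
      · exact absurd h (disjoint_left.1 hTY hx.1)) φ.continuous.continuousOn continuousOn_const))
    (fun x _ => hval _ (by
      rw [AddCircle.coe_sub, hθ']
      split_ifs <;> simp)) hpT hqT
  have h2 := eq_of_integer_valued hS (m := fun x => θ x - if x ∈ V then φ x - 1 else 0)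
    (θ.continuous.continuousOn.sub (ContinuousOn.if (fun x hx => by
      rcases hfr x hx.2 with h | h
      · exact absurd h (disjoint_left.1 hSX hx.1)
      · rw [hφY h]; simp) (φ.continuous.sub continuous_const).continuousOn continuousOn_const))
    (fun x _ => hval _ (by
      rw [AddCircle.coe_sub, hθ']
      split_ifs
      · rw [AddCircle.coe_sub, hperiod]; simp
      · simp)) hpS hqS
  simp only [hpV, hq, if_true, if_false] at h1 h2
  linarith

lemma connectedComponentIn_eq_left {E : Type*} [TopologicalSpace E] {F U V : Set E}
    (hU : IsOpen U) (hV : IsOpen V) (hUV : Disjoint U V) (hF : U ∪ V = F)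
    (hUc : IsPreconnected U) {x : E} (hx : x ∈ U) : connectedComponentIn F x = U := by
  have hxF : x ∈ F := hF ▸ Or.inl hx
  refine Subset.antisymm ?_ (hUc.subset_connectedComponentIn hx (hF ▸ subset_union_left))
  exact isPreconnected_connectedComponentIn.subset_left_of_subset_union hU hV hUV
    (hF ▸ connectedComponentIn_subset F x) ⟨x, mem_connectedComponentIn hxF, hx⟩

lemma frontier_eq_of_union_eq_compl {E : Type*} [TopologicalSpace E] {R U V : Set E}
    (hU : IsOpen U) (hV : IsOpen V) (hUV : Disjoint U V) (hR : U ∪ V = Rᶜ) (hRU : R ⊆ closure U) :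
    frontier U = R := by
  refine Subset.antisymm (fun x hx => ?_) fun x hx => ?_
  · have := frontier_subset_compl_union hV hU hUV.symm hx
    rwa [union_comm, hR, compl_compl] at this
  · rw [hU.frontier_eq]
    exact ⟨hRU hx, fun h => (hR ▸ Or.inl h : x ∈ Rᶜ) hx⟩

end Separation

section Lattice

variable {ι : Type*}

/-- An integer vector, seen as a real vector. -/
def latticePoint (k : ι → ℤ) : ι → ℝ := fun i => k i

@[simp] lemma latticePoint_zero : latticePoint (0 : ι → ℤ) = 0 := by ext; simp [latticePoint]

lemma latticePoint_add (k l : ι → ℤ) : latticePoint (k + l) = latticePoint k + latticePoint l := by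
  ext; simp [latticePoint]

lemma latticePoint_neg (k : ι → ℤ) : latticePoint (-k) = -latticePoint k := by
  ext; simp [latticePoint]

lemma latticePoint_sub (k l : ι → ℤ) : latticePoint (k - l) = latticePoint k - latticePoint l := by
  ext; simp [latticePoint]

lemma IsPreconnected.image_add_right {K : Set (ι → ℝ)} (hK : IsPreconnected K) (v : ι → ℝ) :
    IsPreconnected ((fun x => x + v) '' K) := hK.image _ (by fun_prop)

variable [Fintype ι]

lemma one_le_norm_latticePoint {k : ι → ℤ} (hk : k ≠ 0) : 1 ≤ ‖latticePoint k‖ := by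
  obtain ⟨i, hi⟩ := Function.ne_iff.1 hk
  refine le_trans ?_ (norm_le_pi_norm (latticePoint k) i)
  have : (1 : ℤ) ≤ |k i| := Int.one_le_abs hi
  rw [Real.norm_eq_abs, latticePoint]
  exact_mod_cast this

/-- If the boundary of a bounded complementary domain `B` is disjoint from its translates by
nonzero lattice vectors, then these translates lie in the unbounded complementary domain. -/
lemma add_latticePoint_mem {K A B : Set (ι → ℝ)} (hA : IsOpen A) (hB : IsOpen B)
    (hAB : Disjoint A B) (hcov : A ∪ B = Kᶜ) (hAc : IsPreconnected A) (hBc : IsPreconnected B)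
    (hKc : IsPreconnected K) (hKne : K.Nonempty) (hBne : B.Nonempty) {R : ℝ}
    (hR : ∀ x, R < ‖x‖ → x ∈ A) (hKA : K ⊆ closure A) (hKB : K ⊆ closure B)
    (hK : ∀ k : ι → ℤ, k ≠ 0 → ∀ x ∈ K, x + latticePoint k ∉ K) {k : ι → ℤ} (hk : k ≠ 0) {x : ι → ℝ}
    (hx : x ∈ B ∪ K) : x + latticePoint k ∈ A := by
  have hnotA : ∀ y, y ∉ A ↔ y ∈ B ∪ K := by
    intro y
    have h1 : y ∈ A ∪ B ↔ y ∉ K := by rw [hcov]; rfl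
    have h2 : y ∈ A → y ∉ B := fun h => disjoint_left.1 hAB h
    simp only [mem_union] at h1 ⊢
    tauto
  have hAK : IsPreconnected (A ∪ K) :=
    hAc.subset_closure subset_union_left (union_subset subset_closure hKA)
  have hBK : IsPreconnected (B ∪ K) :=
    hBc.subset_closure subset_union_left (union_subset subset_closure hKB)
  -- the images of `A ∪ K` and `B ∪ K` under translation avoid `K` as soon as `K` avoids them
  have hKt : ∀ k : ι → ℤ, k ≠ 0 → ∀ x ∈ K, x + latticePoint k ∈ A := by
    intro k hk
    have h1 : (fun x => x + latticePoint k) '' K ⊆ A ∪ B := by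
      rw [hcov]
      rintro _ ⟨x, hx, rfl⟩
      exact hK k hk x hx
    rcases (hKc.image_add_right (latticePoint k)).subset_or_subset hA hB hAB h1 with h | h
    · exact fun x hx => h (mem_image_of_mem _ hx)
    exfalso
    have h2 : (fun x => x + latticePoint (-k)) '' (A ∪ K) ⊆ A ∪ B := by
      rw [hcov]
      rintro _ ⟨x, hx, rfl⟩ hxK
      have h3 := h (mem_image_of_mem _ hxK)
      simp only [latticePoint_neg, neg_add_cancel_right] at h3
      rcases hx with hx | hx
      · exact disjoint_left.1 hAB hx h3
      · have : x ∈ A ∪ B := Or.inr h3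
        rw [hcov] at this
        exact this hx
    have h4 : (fun x => x + latticePoint (-k)) '' (A ∪ K) ⊆ A := by
      rcases (hAK.image_add_right _).subset_or_subset hA hB hAB h2 with h | h
      · exact h
      exfalso
      have hk0 : 0 < ‖latticePoint k‖ := zero_lt_one.trans_le (one_le_norm_latticePoint hk)
      set y : ι → ℝ := ((|R| + 1 + ‖latticePoint k‖) / ‖latticePoint k‖) • latticePoint k with hy
      have hyn : ‖y‖ = |R| + 1 + ‖latticePoint k‖ := by
        rw [hy, norm_smul, Real.norm_of_nonneg (by positivity), div_mul_cancel₀ _ hk0.ne']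
      have hyA : y ∈ A := hR y (by rw [hyn]; linarith [le_abs_self R])
      have h5 := h (mem_image_of_mem _ (Or.inl hyA : y ∈ A ∪ K))
      refine disjoint_left.1 hAB (hR _ ?_) h5
      have h6 := norm_sub_norm_le y (latticePoint k)
      simp only [latticePoint_neg, ← sub_eq_add_neg]
      linarith [le_abs_self R]
    have h5 : ∀ y ∈ B, y + latticePoint k ∈ B := by
      intro y hy
      by_contra hyB
      have h6 : y + latticePoint k ∈ A ∪ K := by
        by_contra h7
        have : y + latticePoint k ∈ B ∪ K := (hnotA _).1 fun h => h7 (Or.inl h)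
        exact this.elim hyB fun h => h7 (Or.inr h)
      have h7 := h4 (mem_image_of_mem _ h6)
      simp only [latticePoint_neg, add_neg_cancel_right] at h7
      exact disjoint_left.1 hAB h7 hy
    obtain ⟨y, hy⟩ := hBne
    have h6 : ∀ m : ℕ, y + (m : ℝ) • latticePoint k ∈ B := by
      intro m
      induction m with
      | zero => simpa using hy
      | succ m ih =>
        have := h5 _ ih
        convert this using 1
        push_cast
        module
    obtain ⟨m, hm⟩ := exists_nat_gt (R + ‖y‖)
    refine disjoint_left.1 hAB (hR _ ?_) (h6 m)
    have h7 : (m : ℝ) ≤ ‖(m : ℝ) • latticePoint k‖ := by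
      rw [norm_smul, Real.norm_natCast]
      exact le_mul_of_one_le_right (Nat.cast_nonneg m) (one_le_norm_latticePoint hk)
    have h8 := norm_sub_norm_le ((m : ℝ) • latticePoint k) (-y)
    rw [norm_neg, sub_neg_eq_add, add_comm _ y] at h8
    linarith
  have h1 : (fun x => x + latticePoint k) '' (B ∪ K) ⊆ A ∪ B := by
    rw [hcov]
    rintro _ ⟨x, hx, rfl⟩ hxK
    have h2 := hKt (-k) (neg_ne_zero.2 hk) _ hxK
    rw [latticePoint_neg, add_neg_cancel_right] at h2
    exact (hnotA x).2 hx h2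
  rcases (hBK.image_add_right _).subset_or_subset hA hB hAB h1 with h | h
  · exact h (mem_image_of_mem _ hx)
  · exfalso
    obtain ⟨y, hy⟩ := hKne
    exact disjoint_left.1 hAB (hKt k hk y hy) (h (mem_image_of_mem _ (Or.inr hy)))

/-- Translating a bounded closed set by lattice vectors gives a locally finite family. -/
lemma locallyFinite_sub_latticePoint {C : Set (ι → ℝ)} {R : ℝ} (hR : ∀ x ∈ C, ‖x‖ ≤ R) :
    LocallyFinite fun k : ι → ℤ => {x | x - latticePoint k ∈ C} := by
  classical
  intro x
  refine ⟨Metric.ball x 1, Metric.ball_mem_nhds x one_pos, ?_⟩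
  obtain ⟨M, hM⟩ := exists_nat_gt (R + ‖x‖ + 1)
  refine (finite_Icc (fun _ : ι => -(M : ℤ)) fun _ => (M : ℤ)).subset ?_
  rintro k ⟨y, hy, hyx⟩
  have h1 : ‖latticePoint k‖ ≤ M := by
    have h2 := hR _ hy
    have h3 : ‖y - x‖ < 1 := by simpa [dist_eq_norm] using hyx
    have h4 : latticePoint k = x + (y - x) - (y - latticePoint k) := by abel
    rw [h4]
    linarith [norm_sub_le (x + (y - x)) (y - latticePoint k), norm_add_le x (y - x)]
  have h5 : ∀ i, |k i| ≤ (M : ℤ) := by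
    intro i
    have := (norm_le_pi_norm (latticePoint k) i).trans h1
    rw [Real.norm_eq_abs, latticePoint] at this
    exact_mod_cast this
  exact ⟨fun i => (abs_le.1 (h5 i)).1, fun i => (abs_le.1 (h5 i)).2⟩

/-- The complement of the lattice translates of a nonseparating connected compact set that are
pairwise disjoint is connected. -/
lemma isPreconnected_compl_iUnion_translates {C : Set (ι → ℝ)} (hC : IsCompact C)
    (hCc : IsPreconnected C) (hcompl : IsPreconnected Cᶜ)
    (hdisj : ∀ k : ι → ℤ, k ≠ 0 → ∀ x ∈ C, x + latticePoint k ∉ C) :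
    IsPreconnected (⋃ k : ι → ℤ, {x | x - latticePoint k ∈ C})ᶜ ∧
      ∃ N : Set (ι → ℝ), IsOpen N ∧ C ⊆ N ∧
        N ∩ Cᶜ ⊆ (⋃ k : ι → ℤ, {x | x - latticePoint k ∈ C})ᶜ := by
  obtain ⟨R, hR⟩ := hC.isBounded.exists_norm_le
  have hlf := locallyFinite_sub_latticePoint hR
  have hcl : ∀ k : ι → ℤ, IsClosed {x | x - latticePoint k ∈ C} := fun k =>
    hC.isClosed.preimage (by fun_prop : Continuous fun x => x - latticePoint k)
  set D : Set (ι → ℝ) := (⋃ k : ι → ℤ, {x | x - latticePoint k ∈ C})ᶜ with hD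
  have hDo : IsOpen D := (hlf.isClosed_iUnion hcl).isOpen_compl
  have hDmem : ∀ x, x ∈ D ↔ ∀ k, x - latticePoint k ∉ C := fun x => by simp [hD]
  have hDt : ∀ x (k : ι → ℤ), x + latticePoint k ∈ D ↔ x ∈ D := by
    intro x k
    rw [hDmem, hDmem]
    constructor
    · intro h l hl
      refine h (l + k) ?_
      rwa [latticePoint_add, add_sub_add_right_eq_sub]
    · intro h l hl
      refine h (l - k) ?_
      rwa [latticePoint_sub, sub_sub_eq_add_sub]
  set Y : Set (ι → ℝ) := ⋃ k : {k : ι → ℤ // k ≠ 0}, {x | x - latticePoint k.1 ∈ C} with hY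
  have hYcl : IsClosed Y :=
    (hlf.comp_injective Subtype.val_injective).isClosed_iUnion fun k => hcl k.1
  have hCY : Disjoint C Y := by
    rw [disjoint_left]
    intro x hx hxY
    obtain ⟨k, hk⟩ := mem_iUnion.1 hxY
    refine hdisj k.1 k.2 _ hk ?_
    rwa [sub_add_cancel]
  have hCYD : (C ∪ Y)ᶜ = D := by
    ext x
    rw [hDmem]
    constructor
    · intro h k hk
      by_cases hk0 : k = 0
      · subst hk0
        exact h (Or.inl (by simpa using hk))
      · exact h (Or.inr (mem_iUnion.2 ⟨⟨k, hk0⟩, hk⟩))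
    · rintro h (hx | hx)
      · exact h 0 (by simpa using hx)
      · obtain ⟨k, hk⟩ := mem_iUnion.1 hx
        exact h k.1 hk
  obtain ⟨r, hr, hrd⟩ := hCY.exists_thickenings hC hYcl
  set N := Metric.thickening r C with hN
  have hNo : IsOpen N := Metric.isOpen_thickening
  have hCN : C ⊆ N := Metric.self_subset_thickening hr C
  have hNY : Disjoint N Y := hrd.mono_right (Metric.self_subset_thickening hr Y)
  have hNc : IsPreconnected N := by
    rw [hN, ← add_ball_zero, ← image2_add, ← image_prod]
    exact (hCc.prod (convex_ball (0 : ι → ℝ) r).isPreconnected).image _ (by fun_prop)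
  have hNCD : N ∩ Cᶜ ⊆ D := by
    rw [← hCYD]
    rintro x ⟨hxN, hxC⟩ (h | h)
    exacts [hxC h, disjoint_left.1 hNY hxN h]
  have hDC : Disjoint Cᶜ C := disjoint_compl_left
  have hsep : ∀ U V : Set (ι → ℝ), IsOpen U → IsOpen V → Disjoint U V → U ∪ V = D →
      ∀ p ∈ U, ∀ q ∈ V, p ∈ N → q ∈ N → False := by
    intro U V hU hV hUV hcov p hp q hq hpN hqN
    have hmem : ∀ x ∈ D, x ∈ Cᶜ := fun x hx hxC => (hDmem x).1 hx 0 (by simpa using hxC)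
    exact not_separated_of_disjoint hC.isClosed hYcl hCY hU hV hUV (hcov.trans hCYD.symm) hp hq
      hcompl hNc hDC hNY (hmem p (hcov ▸ Or.inl hp)) (hmem q (hcov ▸ Or.inr hq)) hpN hqN
  have hsept : ∀ U V : Set (ι → ℝ), IsOpen U → IsOpen V → Disjoint U V → U ∪ V = D →
      ∀ k : ι → ℤ, ∀ p ∈ U, ∀ q ∈ V, p - latticePoint k ∈ N → q - latticePoint k ∈ N → False := by
    intro U V hU hV hUV hcov k p hp q hq hpN hqN
    have hc : Continuous fun x : ι → ℝ => x + latticePoint k := by fun_prop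
    refine hsep ((fun x => x + latticePoint k) ⁻¹' U) ((fun x => x + latticePoint k) ⁻¹' V)
      (hU.preimage hc) (hV.preimage hc) (hUV.preimage _) ?_ (p - latticePoint k) (by simpa using hp)
      (q - latticePoint k) (by simpa using hq) hpN hqN
    rw [← preimage_union, hcov]
    ext x
    exact hDt x k
  refine ⟨?_, N, hNo, hCN, hNCD⟩
  rw [isPreconnected_iff_subset_of_disjoint]
  intro u v hu hv huv hd
  set U := D ∩ u with hU
  set V := D ∩ v with hV
  have hUo : IsOpen U := hDo.inter hu
  have hVo : IsOpen V := hDo.inter hv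
  have hUV : Disjoint U V := by
    rw [disjoint_left]
    rintro x ⟨hxD, hxu⟩ ⟨-, hxv⟩
    exact (hd ▸ (⟨hxD, hxu, hxv⟩ : x ∈ D ∩ (u ∩ v)) : x ∈ (∅ : Set (ι → ℝ)))
  have hcov : U ∪ V = D := by rw [hU, hV, ← inter_union_distrib_left, inter_eq_left.2 huv]
  by_contra! hcon
  obtain ⟨⟨x₁, hx₁D, hx₁⟩, x₂, hx₂D, hx₂⟩ := And.intro (not_subset.1 hcon.1) (not_subset.1 hcon.2)
  -- attach each translate to the side that its neighbourhood meets
  set U' : Set (ι → ℝ) := U ∪ {x | ∃ k : ι → ℤ, x - latticePoint k ∈ C ∧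
    ∀ y ∈ V, y - latticePoint k ∉ N} with hU'
  set V' : Set (ι → ℝ) := V ∪ {x | ∃ k : ι → ℤ, x - latticePoint k ∈ C ∧
    ∃ y ∈ V, y - latticePoint k ∈ N} with hV'
  have hnhds : ∀ x (k : ι → ℤ), x - latticePoint k ∈ C → ∀ᶠ y in 𝓝 x, y - latticePoint k ∈ N :=
    fun x k hx => (by fun_prop : Continuous fun x => x - latticePoint k).continuousAt.eventually_mem
      (hNo.mem_nhds (hCN hx))
  have hND : ∀ y (k : ι → ℤ), y - latticePoint k ∈ N → y - latticePoint k ∉ C → y ∈ D := by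
    intro y k h1 h2
    have := hNCD ⟨h1, h2⟩
    rwa [← hDt _ k, sub_add_cancel] at this
  have hU'o : IsOpen U' := by
    rw [isOpen_iff_mem_nhds]
    rintro x (hx | ⟨k, hxC, hk⟩)
    · exact mem_of_superset (hUo.mem_nhds hx) subset_union_left
    · filter_upwards [hnhds x k hxC] with y hy
      by_cases hyC : y - latticePoint k ∈ C
      · exact Or.inr ⟨k, hyC, hk⟩
      · have hyD := hND y k hy hyC
        rw [← hcov] at hyD
        exact Or.inl (hyD.resolve_right fun h => hk y h hy)
  have hV'o : IsOpen V' := by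
    rw [isOpen_iff_mem_nhds]
    rintro x (hx | ⟨k, hxC, z, hzV, hzN⟩)
    · exact mem_of_superset (hVo.mem_nhds hx) subset_union_left
    · filter_upwards [hnhds x k hxC] with y hy
      by_cases hyC : y - latticePoint k ∈ C
      · exact Or.inr ⟨k, hyC, z, hzV, hzN⟩
      · have hyD := hND y k hy hyC
        rw [← hcov] at hyD
        exact Or.inl (hyD.resolve_left fun h => hsept U V hUo hVo hUV hcov k y h z hzV hy hzN)
  have hall : (univ : Set (ι → ℝ)) ⊆ U' ∪ V' := by
    intro x _
    by_cases hx : x ∈ D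
    · rw [← hcov] at hx
      rcases hx with h | h
      exacts [Or.inl (Or.inl h), Or.inr (Or.inl h)]
    · rw [hDmem] at hx
      push Not at hx
      obtain ⟨k, hk⟩ := hx
      by_cases h : ∃ y ∈ V, y - latticePoint k ∈ N
      · exact Or.inr (Or.inr ⟨k, hk, h⟩)
      · push Not at h
        exact Or.inl (Or.inr ⟨k, hk, h⟩)
  have hmemU : x₂ ∈ U := ⟨hx₂D, (huv hx₂D).resolve_right hx₂⟩
  have hmemV : x₁ ∈ V := ⟨hx₁D, (huv hx₁D).resolve_left hx₁⟩
  obtain ⟨x, -, hxU, hxV⟩ := isPreconnected_univ U' V' hU'o hV'o hall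
    ⟨x₂, mem_univ _, Or.inl hmemU⟩ ⟨x₁, mem_univ _, Or.inl hmemV⟩
  have hUD : ∀ x ∈ U, ∀ k, x - latticePoint k ∉ C := fun x hx => (hDmem x).1 hx.1
  have hVD : ∀ x ∈ V, ∀ k, x - latticePoint k ∉ C := fun x hx => (hDmem x).1 hx.1
  rcases hxU with hxU | ⟨k, hxC, hk⟩ <;> rcases hxV with hxV | ⟨l, hxC', z, hzV, hzN⟩
  · exact disjoint_left.1 hUV hxU hxV
  · exact hUD x hxU l hxC'
  · exact hVD x hxV k hxC
  · have hkl : k = l := by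
      by_contra hkl
      refine hdisj (k - l) (sub_ne_zero.2 hkl) _ hxC ?_
      rw [latticePoint_sub]
      convert hxC' using 1
      abel
    subst hkl
    exact hk z hzV hzN

end Lattice

section Torus

variable {ι : Type*}

/-- The universal covering map of the torus. -/
def torusMk (y : ι → ℝ) : ι → AddCircle (1 : ℝ) := fun i => (y i : AddCircle (1 : ℝ))

lemma continuous_torusMk : Continuous (torusMk (ι := ι)) :=
  continuous_pi fun i => (AddCircle.continuous_mk' 1).comp (continuous_apply i)

lemma surjective_torusMk : Function.Surjective (torusMk (ι := ι)) := fun x =>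
  ⟨fun i => (QuotientAddGroup.mk_surjective (x i)).choose,
    funext fun i => (QuotientAddGroup.mk_surjective (x i)).choose_spec⟩

lemma isOpenMap_torusMk [Finite ι] : IsOpenMap (torusMk (ι := ι)) :=
  IsOpenMap.piMap (fun _ => QuotientAddGroup.isOpenMap_coe)
    (Eventually.of_forall fun _ => QuotientAddGroup.mk_surjective)

lemma torusMk_eq_iff {x y : ι → ℝ} :
    torusMk x = torusMk y ↔ ∃ k : ι → ℤ, y = x + latticePoint k := by
  have h1 : ∀ i, torusMk x i = torusMk y i ↔ ∃ m : ℤ, y i = x i + m := by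
    intro i
    rw [torusMk, torusMk, eq_comm, ← sub_eq_zero, ← AddCircle.coe_sub,
      AddCircle.coe_eq_zero_iff]
    simp only [zsmul_eq_mul, mul_one, eq_sub_iff_add_eq]
    exact exists_congr fun m => by rw [eq_comm, add_comm]
  rw [funext_iff]
  simp only [h1]
  rw [Classical.skolem]
  exact exists_congr fun k => by rw [funext_iff]; rfl

/-- A map to the torus lifts to `ℝⁿ` if all loops in its range are null-homotopic. -/
lemma exists_torus_lift {A : Type*} [TopologicalSpace A] [PathConnectedSpace A]
    [LocallyPathConnectedSpace A] {s : A → ι → AddCircle (1 : ℝ)} (hs : Continuous s)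
    (hnull : ∀ (x : ι → AddCircle (1 : ℝ)) (γ : Path x x), range γ ⊆ range s →
      γ.Homotopic (Path.refl x)) :
    ∃ F : C(A, ι → ℝ), ∀ a, torusMk (F a) = s a := by
  obtain ⟨a₀⟩ := (inferInstance : Nonempty A)
  have hlift : ∀ i, ∃ F : C(A, ℝ), ∀ a, (F a : AddCircle (1 : ℝ)) = s a i := by
    intro i
    obtain ⟨e₀, he⟩ := QuotientAddGroup.mk_surjective (s a₀ i)
    have hsi : Continuous fun a => s a i := (continuous_apply i).comp hs
    obtain ⟨F, ⟨-, hF⟩, -⟩ :=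
      (AddCircle.isCoveringMap_coe (1 : ℝ)).existsUnique_continuousMap_lifts_of_range_le
        (f := ⟨fun a => s a i, hsi⟩) (a₀ := a₀) (e₀ := e₀) he (by
          rintro _ ⟨g, rfl⟩
          refine (?_ : FundamentalGroup.map ⟨fun a => s a i, hsi⟩ a₀ g = 1) ▸ one_mem _
          obtain ⟨γ, rfl⟩ := Quotient.exists_rep g
          have h := hnull _ (γ.map hs) (by
            rintro _ ⟨t, rfl⟩
            exact mem_range_self _)
          exact Quotient.sound (h.map ⟨fun x => x i, continuous_apply i⟩))
    exact ⟨F, congrFun hF⟩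
  choose F hF using hlift
  exact ⟨⟨fun a i => F i a, by fun_prop⟩, fun a => funext fun i => hF i a⟩

variable [Fintype ι]

/-- Jordan–Brouwer separation for spheres embedded in `ℝⁿ`. -/
lemma exists_jordan_brouwer_of_sphere [DecidableEq ι] (hι : 1 < Fintype.card ι)
    (F : C(Metric.sphere (0 : EuclideanSpace ℝ ι) 1, ι → ℝ)) (hF : Function.Injective F) :
    ∃ A B : Set (ι → ℝ), IsOpen A ∧ IsOpen B ∧ Disjoint A B ∧ A ∪ B = (range F)ᶜ ∧
      IsPreconnected A ∧ IsPreconnected B ∧ B.Nonempty ∧ (∃ R : ℝ, ∀ x, R < ‖x‖ → x ∈ A) ∧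
      range F ⊆ closure A ∧ range F ⊆ closure B := by
  have hj : Continuous fun x : Metric.sphere (0 : EuclideanSpace ℝ ι) 1 => WithLp.ofLp x.1 :=
    (PiLp.continuous_ofLp 2 _).comp continuous_subtype_val
  have hj_inj : Function.Injective
      fun x : Metric.sphere (0 : EuclideanSpace ℝ ι) 1 => WithLp.ofLp x.1 :=
    (WithLp.ofLp_injective 2).comp Subtype.val_injective
  obtain ⟨f, hf⟩ := ContinuousMap.exists_extension
    (F.continuous.isClosedEmbedding hF) ⟨_, hj⟩
  obtain ⟨g, hg⟩ := ContinuousMap.exists_extension (hj.isClosedEmbedding hj_inj) F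
  have hf' : ∀ x, f (F x) = WithLp.ofLp x.1 := fun x => DFunLike.congr_fun hf x
  have hg' : ∀ x : Metric.sphere (0 : EuclideanSpace ℝ ι) 1, g (WithLp.ofLp x.1) = F x :=
    fun x => DFunLike.congr_fun hg x
  refine exists_jordan_brouwer hι (isCompact_range F.continuous) f.continuous g.continuous ?_ ?_
  · rintro _ ⟨x, rfl⟩
    rw [hf', hg']
  · ext y
    constructor
    · rintro ⟨_, ⟨x, rfl⟩, rfl⟩
      rw [hf']
      exact mem_sphere_zero_iff_norm.1 x.2
    · intro hy
      refine ⟨_, ⟨⟨WithLp.toLp 2 y, mem_sphere_zero_iff_norm.2 hy⟩, rfl⟩, ?_⟩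
      rw [hf']

/-- The Jordan–Brouwer separation theorem for spheres in the torus that lift to `ℝⁿ`. -/
lemma exists_torus_separation [DecidableEq ι] (hι : 1 < Fintype.card ι)
    (F : C(Metric.sphere (0 : EuclideanSpace ℝ ι) 1, ι → ℝ))
    [PreconnectedSpace (Metric.sphere (0 : EuclideanSpace ℝ ι) 1)]
    [Nonempty (Metric.sphere (0 : EuclideanSpace ℝ ι) 1)]
    (hF : Function.Injective fun x => torusMk (F x)) :
    ∃ U V : Set (ι → AddCircle (1 : ℝ)), IsOpen U ∧ IsOpen V ∧ Disjoint U V ∧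
      U ∪ V = (range fun x => torusMk (F x))ᶜ ∧ IsPreconnected U ∧ IsPreconnected V ∧
      U.Nonempty ∧ V.Nonempty ∧ (range fun x => torusMk (F x)) ⊆ closure U ∧
      (range fun x => torusMk (F x)) ⊆ closure V := by
  obtain ⟨A, B, hA, hB, hAB, hcov, hAc, hBc, hBne, ⟨R, hR⟩, hKA, hKB⟩ :=
    exists_jordan_brouwer_of_sphere hι F fun x y h => hF (congrArg torusMk h)
  set K := range F with hKdef
  have hKc : IsPreconnected K := isPreconnected_range F.continuous
  have hKne : K.Nonempty := range_nonempty F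
  have hK : ∀ k : ι → ℤ, k ≠ 0 → ∀ x ∈ K, x + latticePoint k ∉ K := by
    rintro k hk _ ⟨a, rfl⟩ ⟨b, hb⟩
    have hab : a = b := hF (torusMk_eq_iff.2 ⟨k, hb⟩)
    subst hab
    have h0 : latticePoint k = 0 := by simpa using hb.symm
    have h1 := one_le_norm_latticePoint hk
    rw [h0, norm_zero] at h1
    linarith
  have htrans : ∀ k : ι → ℤ, k ≠ 0 → ∀ x ∈ B ∪ K, x + latticePoint k ∈ A := fun k hk x hx =>
    add_latticePoint_mem hA hB hAB hcov hAc hBc hKc hKne hBne hR hKA hKB hK hk hx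
  have hCA : (B ∪ K)ᶜ = A := by
    ext x
    have h1 : x ∈ A ∪ B ↔ x ∉ K := by rw [hcov]; rfl
    have h2 : x ∈ A → x ∉ B := fun h => disjoint_left.1 hAB h
    simp only [mem_union, mem_compl_iff] at h1 ⊢
    tauto
  have hCcl : IsClosed (B ∪ K) := by rw [← isOpen_compl_iff, hCA]; exact hA
  have hCcpt : IsCompact (B ∪ K) := by
    refine Metric.isCompact_of_isClosed_isBounded hCcl
      ((Metric.isBounded_closedBall (x := (0 : ι → ℝ)) (r := R)).subset fun x hx => ?_)
    rw [mem_closedBall_zero_iff]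
    by_contra! h
    have := hR x h
    rw [← hCA] at this
    exact this hx
  have hCdisj : ∀ k : ι → ℤ, k ≠ 0 → ∀ x ∈ B ∪ K, x + latticePoint k ∉ B ∪ K := by
    intro k hk x hx
    have := htrans k hk x hx
    rwa [← hCA] at this
  obtain ⟨hDc, N, hN, hCN, hND⟩ := isPreconnected_compl_iUnion_translates hCcpt
    (hBc.subset_closure subset_union_left (union_subset subset_closure hKB)) (hCA.symm ▸ hAc) hCdisj
  have hDo : IsOpen (⋃ k : ι → ℤ, {x | x - latticePoint k ∈ B ∪ K})ᶜ := by
    obtain ⟨R', hR'⟩ := hCcpt.isBounded.exists_norm_le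
    exact ((locallyFinite_sub_latticePoint hR').isClosed_iUnion fun k => hCcl.preimage
      (by fun_prop : Continuous fun x => x - latticePoint k)).isOpen_compl
  set D := (⋃ k : ι → ℤ, {x | x - latticePoint k ∈ B ∪ K})ᶜ with hD
  have hDmem : ∀ x, x ∈ D ↔ ∀ k, x - latticePoint k ∉ B ∪ K := fun x => by simp [hD]
  rw [hCA] at hND
  have hKD : K ⊆ closure D := by
    intro x hx
    rw [mem_closure_iff_nhds]
    intro t ht
    obtain ⟨y, ⟨hyt, hyN⟩, hyA⟩ := mem_closure_iff_nhds.1 (hKA hx) (t ∩ N)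
      (inter_mem ht (hN.mem_nhds (hCN (Or.inr hx))))
    exact ⟨y, hyt, hND ⟨hyN, hyA⟩⟩
  have hrange : (range fun x => torusMk (F x)) = torusMk '' K := range_comp torusMk F
  have hBK : Disjoint B K := by
    rw [disjoint_left]
    intro x hx
    exact (hcov ▸ Or.inr hx : x ∈ Kᶜ)
  have hcase : ∀ x ∈ B ∪ K, ∀ y ∈ B ∪ K, torusMk x = torusMk y → x = y := by
    intro x hx y hy hxy
    obtain ⟨k, rfl⟩ := torusMk_eq_iff.1 hxy
    by_cases hk : k = 0
    · simp [hk]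
    · exact absurd hy (hCdisj k hk x hx)
  have hDcase : ∀ x ∈ B ∪ K, ∀ y ∈ D, torusMk x ≠ torusMk y := by
    intro x hx y hy hxy
    obtain ⟨k, rfl⟩ := torusMk_eq_iff.1 hxy
    exact (hDmem _).1 hy k (by rwa [add_sub_cancel_right])
  refine ⟨torusMk '' B, torusMk '' D, isOpenMap_torusMk _ hB, isOpenMap_torusMk _ hDo, ?_, ?_,
    hBc.image _ continuous_torusMk.continuousOn, hDc.image _ continuous_torusMk.continuousOn,
    hBne.image _, (closure_nonempty_iff.1 (hKne.mono hKD)).image _, ?_, ?_⟩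
  · rw [disjoint_left]
    rintro _ ⟨x, hx, rfl⟩ ⟨y, hy, hxy⟩
    exact hDcase x (Or.inl hx) y hy hxy.symm
  · rw [hrange]
    ext z
    constructor
    · rintro (⟨x, hx, rfl⟩ | ⟨x, hx, rfl⟩) ⟨y, hy, hxy⟩
      · have := hcase y (Or.inr hy) x (Or.inl hx) hxy
        exact disjoint_left.1 hBK hx (this ▸ hy)
      · exact hDcase y (Or.inr hy) x hx hxy
    · intro hz
      obtain ⟨x, rfl⟩ := surjective_torusMk z
      by_cases hx : x ∈ D
      · exact Or.inr (mem_image_of_mem _ hx)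
      · rw [hDmem] at hx
        push Not at hx
        obtain ⟨k, hk⟩ := hx
        have hxk : torusMk (x - latticePoint k) = torusMk x :=
          torusMk_eq_iff.2 ⟨k, by abel⟩
        rcases hk with hk | hk
        · exact Or.inl ⟨_, hk, hxk⟩
        · exact absurd ⟨_, hk, hxk⟩ hz
  · rw [hrange]
    exact (image_mono hKB).trans (image_closure_subset_closure_image continuous_torusMk)
  · rw [hrange]
    exact (image_mono hKD).trans (image_closure_subset_closure_image continuous_torusMk)

end Torus

end JordanBrouwerTorus

/-- Let `T = ℝⁿ/ℤⁿ` (n ≥ 2) and let `s : S^{n-1} → T` be continuous and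
injective such that every loop contained in `s(S^{n-1})` is null-homotopic in `T`.  Then
`T \ s(S^{n-1})` has exactly two connected components, and `s(S^{n-1})` is the
topological boundary of each of them. -/
theorem sphere_separates_torus (n : ℕ) (hn : 2 ≤ n)
    (s : Metric.sphere (0 : EuclideanSpace ℝ (Fin n)) 1 → (Fin n → AddCircle (1 : ℝ)))
    (hs_cont : Continuous s) (hs_inj : Function.Injective s)
    (hnull : ∀ (x : Fin n → AddCircle (1 : ℝ)) (γ : Path x x),
      Set.range γ ⊆ Set.range s → γ.Homotopic (Path.refl x)) :
    ∃ U V : Set (Fin n → AddCircle (1 : ℝ)), U ≠ V ∧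
      (∃ x ∈ (Set.range s)ᶜ, U = connectedComponentIn (Set.range s)ᶜ x) ∧
      (∃ x ∈ (Set.range s)ᶜ, V = connectedComponentIn (Set.range s)ᶜ x) ∧
      (∀ x ∈ (Set.range s)ᶜ, connectedComponentIn (Set.range s)ᶜ x = U ∨
        connectedComponentIn (Set.range s)ᶜ x = V) ∧
      frontier U = Set.range s ∧ frontier V = Set.range s := by
  obtain ⟨m, rfl⟩ : ∃ m, n = m + 1 := ⟨n - 1, by omega⟩
  have : Fact (Module.finrank ℝ (EuclideanSpace ℝ (Fin (m + 1))) = m + 1) := ⟨by simp⟩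
  have hrank : 1 < Module.rank ℝ (EuclideanSpace ℝ (Fin (m + 1))) := by
    rw [← Module.finrank_eq_rank, this.out]
    exact_mod_cast hn
  have hpc : PathConnectedSpace (Metric.sphere (0 : EuclideanSpace ℝ (Fin (m + 1))) 1) :=
    isPathConnected_iff_pathConnectedSpace.1 (isPathConnected_sphere hrank 0 zero_le_one)
  have hlpc : LocallyPathConnectedSpace (Metric.sphere (0 : EuclideanSpace ℝ (Fin (m + 1))) 1) :=
    ChartedSpace.locallyPathConnectedSpace (EuclideanSpace ℝ (Fin m)) _
  obtain ⟨F, hF⟩ := exists_torus_lift hs_cont hnull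
  obtain rfl : (fun x => torusMk (F x)) = s := funext hF
  obtain ⟨U, V, hU, hV, hUV, hcov, hUc, hVc, ⟨u, hu⟩, ⟨v, hv⟩, hKU, hKV⟩ :=
    exists_torus_separation (by rwa [Fintype.card_fin]) F hs_inj
  have hcov' := (Set.union_comm V U).trans hcov
  refine ⟨U, V, fun h => Set.disjoint_left.1 hUV hu (h ▸ hu),
    ⟨u, hcov ▸ Or.inl hu, (connectedComponentIn_eq_left hU hV hUV hcov hUc hu).symm⟩,
    ⟨v, hcov ▸ Or.inr hv, (connectedComponentIn_eq_left hV hU hUV.symm hcov' hVc hv).symm⟩, ?_,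
    frontier_eq_of_union_eq_compl hU hV hUV hcov hKU,
    frontier_eq_of_union_eq_compl hV hU hUV.symm hcov' hKV⟩
  intro x hx
  rw [← hcov] at hx
  exact hx.imp (connectedComponentIn_eq_left hU hV hUV hcov hUc)
    (connectedComponentIn_eq_left hV hU hUV.symm hcov' hVc)
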